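/- Let (T,(X_1,…,X_s)) be a tableau with substitution of dimension (n_1,…,n_m) over ℚ with distinguished columns q_1 = m−1, q_2 = m and n_{q_1} = n_{q_2} = n, and define g(T,τ) = sgn(τ) · bpf⁰_{T̃^τ}(X_{T̃^τ}) · tr(T^τ_cl) for τ ∈ S_n. If τ ∈ S_n and π ∈ S_τ, then g(T,π) = g(T,τ). -/

import Mathlib

open scoped BigOperators
set_option linter.unusedVariables false

attribute [local instance] Classical.propDecidable

/-- The cells of a shape of dimension `n : ι → ℕ`: the column `i` has `n i` cells. -/
abbrev TabCell {ι : Type} (n : ι → ℕ) : Type := Σ i : ι, Fin (n i)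

/-- A tableau with substitution `(T,(X_1,…,X_s))` of dimension `n : ι → ℕ` with entries
in `A`.  Cells are paired by the involution `mate` (each pair of cells is an arrow going
from the tail cell, where `isTail` holds, to the head cell); `lab` assigns to every
arrow (encoded via either of its two cells) its index `φ ∈ {1,…,s}`; `X j` is the matrix
assigned to the arrows with label `j`, which is an `n_{a''} × n_{a'}` matrix where
`colTail j = a''` and `colHead j = a'` are the tail and head columns of those arrows. -/
structure TabSub (A : Type) [CommRing A] (ι : Type) [Fintype ι] [DecidableEq ι]
    (n : ι → ℕ) (s : ℕ) where
  mate : Equiv.Perm (TabCell n)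
  isTail : TabCell n → Bool
  lab : TabCell n → Fin s
  colTail : Fin s → ι
  colHead : Fin s → ι
  X : ∀ j : Fin s, Matrix (Fin (n (colTail j))) (Fin (n (colHead j))) A
  mate_ne : ∀ c, mate c ≠ c
  mate_invol : ∀ c, mate (mate c) = c
  isTail_mate : ∀ c, isTail (mate c) = !isTail c
  lab_mate : ∀ c, lab (mate c) = lab c
  lab_surj : ∀ j : Fin s, ∃ c, isTail c = true ∧ lab c = j
  colTail_eq : ∀ c, isTail c = true → colTail (lab c) = c.1
  colHead_eq : ∀ c, isTail c = true → colHead (lab c) = (mate c).1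

namespace TabSub

variable {A : Type} [CommRing A] {ι : Type} [Fintype ι] [DecidableEq ι] {n : ι → ℕ} {s : ℕ}

/-- The entry of a (rectangular) matrix at a pair of natural number indices, extended
by zero outside the range. -/
def castEntry {a b : ι} (M : Matrix (Fin (n a)) (Fin (n b)) A) (i j : ℕ) : A :=
  if h : i < n a ∧ j < n b then M ⟨i, h.1⟩ ⟨j, h.2⟩ else 0

/-- The set of tail cells of a tableau; tail cells are in bijection with arrows. -/
noncomputable def tails (T : TabSub A ι n s) : Finset (TabCell n) :=
  Finset.univ.filter fun c => T.isTail c = true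

/-- `sgn(π_1)⋯sgn(π_m)` for a tuple of permutations of the columns. -/
def sgnT (π : ∀ i : ι, Equiv.Perm (Fin (n i))) : ℤ :=
  ∏ i, (Equiv.Perm.sign (π i) : ℤ)

/-- The factor `(X_{φ(a)})_{π_{a''}(''a), π_{a'}('a)}` contributed by the arrow with
tail cell `c`. -/
def entry (T : TabSub A ι n s) (π : ∀ i : ι, Equiv.Perm (Fin (n i))) (c : TabCell n) : A :=
  castEntry (T.X (T.lab c)) (π c.1 c.2 : Fin (n c.1)).1
    ((π (T.mate c).1 (T.mate c).2 : Fin (n (T.mate c).1)).1)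

/-- `bpf⁰_T(X_1,…,X_s)`: the sum over all tuples of permutations. -/
noncomputable def bpf0 (T : TabSub A ι n s) : A :=
  ∑ π : ∀ i : ι, Equiv.Perm (Fin (n i)), sgnT π • ∏ c ∈ T.tails, T.entry π c

/-- The condition on a tuple of permutations appearing in `bpf`: whenever
`φ(a) = φ(b)` and `''a < ''b` then `π_i(''a) < π_i(''b)`. -/
def SortedPi (T : TabSub A ι n s) (π : ∀ i : ι, Equiv.Perm (Fin (n i))) : Prop :=
  ∀ c ∈ T.tails, ∀ d ∈ T.tails, T.lab c = T.lab d → (c.2 : ℕ) < (d.2 : ℕ) →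
    ((π c.1 c.2 : Fin (n c.1)) : ℕ) < ((π d.1 d.2 : Fin (n d.1)) : ℕ)

/-- `bpf_T(X_1,…,X_s)`. -/
noncomputable def bpf (T : TabSub A ι n s) : A :=
  ∑ π ∈ Finset.univ.filter T.SortedPi, sgnT π • ∏ c ∈ T.tails, T.entry π c

/-- Conjugating a tableau with substitution by a column-preserving permutation of the
cells. -/
def permTab (T : TabSub A ι n s) (ρ : Equiv.Perm (TabCell n))
    (hρ : ∀ c, (ρ c).1 = c.1) : TabSub A ι n s where
  mate := (ρ.symm.trans T.mate).trans ρ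
  isTail c := T.isTail (ρ.symm c)
  lab c := T.lab (ρ.symm c)
  colTail := T.colTail
  colHead := T.colHead
  X := T.X
  mate_ne c h := by
    refine T.mate_ne (ρ.symm c) ?_
    simpa using congrArg ρ.symm h
  mate_invol c := by simp [T.mate_invol]
  isTail_mate c := by simpa using T.isTail_mate (ρ.symm c)
  lab_mate c := by simpa using T.lab_mate (ρ.symm c)
  lab_surj j := by
    obtain ⟨c, hc1, hc2⟩ := T.lab_surj j
    exact ⟨ρ c, by simpa using hc1, by simpa using hc2⟩
  colTail_eq c h := by
    have h1 := T.colTail_eq (ρ.symm c) h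
    have h2 : (ρ (ρ.symm c)).1 = (ρ.symm c).1 := hρ (ρ.symm c)
    simpa [h1] using h2.symm
  colHead_eq c h := by
    have h1 := T.colHead_eq (ρ.symm c) h
    have h2 := hρ (T.mate (ρ.symm c))
    simp only [Equiv.trans_apply]
    rw [h1, h2]

/-- The permutation of the cells permuting the cells of column `q` by `τ`. -/
def colPerm (n : ι → ℕ) (q : ι) (τ : Equiv.Perm (Fin (n q))) : Equiv.Perm (TabCell n) :=
  Equiv.sigmaCongrRight fun i =>
    if h : i = q then ((finCongr (congrArg n h)).permCongr.symm τ) else Equiv.refl _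

/-- The tableau `T^τ` obtained from `T` by permuting the cells of column `q` by `τ`. -/
def tw (T : TabSub A ι n s) (q : ι) (τ : Equiv.Perm (Fin (n q))) : TabSub A ι n s :=
  T.permTab (colPerm n q τ) (fun _ => rfl)

end TabSub

namespace TabSub

variable {A : Type} [CommRing A] {ι : Type} [Fintype ι] [DecidableEq ι] {n : ι → ℕ} {s : ℕ}

/-! ### Oriented arrows, paths, and the matrices they carry

An element `a ∈t T` (an arrow of `T` or the transpose of one) is encoded by a cell `c`:
the oriented arrow with tail cell `c` and head cell `T.mate c`.  If `c` is a tail cell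
this is the arrow itself, otherwise it is the transpose of an arrow. -/

/-- The letter `φ(a) ∈ M_T` of an oriented arrow: its label together with a flag telling
whether it is transposed. -/
def letter (T : TabSub A ι n s) (c : TabCell n) : Fin s × Bool := (T.lab c, !T.isTail c)

/-- The word `φ(a_1)⋯φ(a_r) ∈ M_T` of a word of oriented arrows. -/
def word (T : TabSub A ι n s) (l : List (TabCell n)) : List (Fin s × Bool) :=
  l.map T.letter

/-- The entries (as a function on natural number indices, extended by zero) of the
matrix `X_{φ(a)}` assigned to an oriented arrow: rows are indexed by its tail column,
columns by its head column; for a transposed arrow this is the transposed matrix. -/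
def matOf (T : TabSub A ι n s) (c : TabCell n) : ℕ → ℕ → A :=
  fun i j => if T.isTail c then castEntry (T.X (T.lab c)) i j else castEntry (T.X (T.lab c)) j i

/-- The product of a list of `ℕ×ℕ`-indexed matrices, all summations being over
`Finset.range B`. -/
def matListProd (B : ℕ) : List (ℕ → ℕ → A) → ℕ → ℕ → A
  | [] => fun i j => if i = j then 1 else 0
  | f :: fs => fun i j => ∑ p ∈ Finset.range B, f i p * matListProd B fs p j

/-- A bound exceeding the sizes of all matrices involved. -/
def dimBound (n : ι → ℕ) [Fintype ι] : ℕ := ∑ i, n i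

/-- The entries of the product matrix `X_{φ(a_1)}⋯X_{φ(a_r)}` of a word of oriented
arrows (the product being `0` if the sizes do not match). -/
def pathMat (T : TabSub A ι n s) (l : List (TabCell n)) : ℕ → ℕ → A :=
  matListProd (dimBound n) (l.map T.matOf)

/-- The trace of the matrix of a (closed) word of oriented arrows. -/
def pathTr (T : TabSub A ι n s) (l : List (TabCell n)) : A :=
  ∑ p ∈ Finset.range (dimBound n), T.pathMat l p p

/-- The entries of the matrix `X_u` of a word `u ∈ M_T` in the letters
`1,…,s,1ᵗ,…,sᵗ` (the product being `0` if the sizes do not match). -/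
def wordMat (T : TabSub A ι n s) (w : List (Fin s × Bool)) : ℕ → ℕ → A :=
  matListProd (dimBound n)
    (w.map fun p => fun i j =>
      if p.2 then castEntry (T.X p.1) j i else castEntry (T.X p.1) i j)

/-- `σ_k(X)`: the coefficient in the characteristic polynomial defined by
`det(λE − X) = λ^n − σ_1(X)λ^{n−1} + ⋯ + (−1)^n σ_n(X)`. -/
noncomputable def sigmaCoeff (N : ℕ) (M : Matrix (Fin N) (Fin N) A) (k : ℕ) : A :=
  (-1) ^ k * (Matrix.charpoly M).coeff (N - k)

/-- `σ_k(X_u)` for a word `u ∈ M_T`. -/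
noncomputable def wordSigma (T : TabSub A ι n s) (w : List (Fin s × Bool)) (k : ℕ) : A :=
  sigmaCoeff (dimBound n) (Matrix.of fun i j : Fin (dimBound n) => T.wordMat w i j) k

/-- Oriented arrows `a_1, a_2` are successive (with respect to the distinguished columns
`q_1, q_2`): `a_1', a_2'' ∈ {q_1,q_2}`, `a_1' ≠ a_2''` and `'a_1 = ''a_2`. -/
def Succ (T : TabSub A ι n s) (q1 q2 : ι) (c d : TabCell n) : Prop :=
  ((T.mate c).1 = q1 ∨ (T.mate c).1 = q2) ∧ (d.1 = q1 ∨ d.1 = q2) ∧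
    (T.mate c).1 ≠ d.1 ∧ ((T.mate c).2 : ℕ) = (d.2 : ℕ)

/-- A path in `T` with respect to the columns `q_1` and `q_2`: a (nonempty, repetition
free) word of oriented arrows in which consecutive arrows are successive. -/
def IsPath (T : TabSub A ι n s) (q1 q2 : ι) (l : List (TabCell n)) : Prop :=
  l ≠ [] ∧ l.Chain' (T.Succ q1 q2) ∧ l.Nodup

/-- An open path: a path passing through the columns `q_1,q_2` whose first tail and
last head lie outside `{q_1,q_2}`. -/
def IsOpenPath (T : TabSub A ι n s) (q1 q2 : ι) (l : List (TabCell n)) : Prop :=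
  T.IsPath q1 q2 l ∧ 2 ≤ l.length ∧ ∀ h : l ≠ [],
    ((l.head h).1 ≠ q1 ∧ (l.head h).1 ≠ q2) ∧
    ((T.mate (l.getLast h)).1 ≠ q1 ∧ (T.mate (l.getLast h)).1 ≠ q2)

/-- A closed path: a path whose last and first arrows are also successive. -/
def IsClosedPath (T : TabSub A ι n s) (q1 q2 : ι) (l : List (TabCell n)) : Prop :=
  T.IsPath q1 q2 l ∧ ∀ h : l ≠ [], T.Succ q1 q2 (l.getLast h) (l.head h)

/-- The transpose `aᵗ = a_rᵗ⋯a_1ᵗ` of a word of oriented arrows. -/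
def tp (T : TabSub A ι n s) (l : List (TabCell n)) : List (TabCell n) :=
  (l.map T.mate).reverse

/-- Equality of words of oriented arrows up to transposition (`=t`). -/
def eqT (T : TabSub A ι n s) (l l' : List (TabCell n)) : Prop :=
  l = l' ∨ l = T.tp l'

/-- Equality of words of oriented arrows up to cyclic permutation and transposition
(`=ct`). -/
def eqCT (T : TabSub A ι n s) (l l' : List (TabCell n)) : Prop :=
  l.IsRotated l' ∨ l.IsRotated (T.tp l')

/-- `R` is a set of representatives of the open paths of `T` (w.r.t. `q_1,q_2`) modulo
the `=t`-equivalence. -/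
def OpenReps (T : TabSub A ι n s) (q1 q2 : ι) (R : Finset (List (TabCell n))) : Prop :=
  (∀ l ∈ R, T.IsOpenPath q1 q2 l) ∧
  ∀ l, T.IsOpenPath q1 q2 l → ∃! l', l' ∈ R ∧ T.eqT l l'

/-- `R` is a set of representatives of the closed paths of `T` (w.r.t. `q_1,q_2`)
modulo the `=ct`-equivalence. -/
def ClosedReps (T : TabSub A ι n s) (q1 q2 : ι) (R : Finset (List (TabCell n))) : Prop :=
  (∀ l ∈ R, T.IsClosedPath q1 q2 l) ∧
  ∀ l, T.IsClosedPath q1 q2 l → ∃! l', l' ∈ R ∧ T.eqCT l l'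

/-- `tr(T_cl) = ∏_{a ∈ T_cl} tr(X_{φ(a)})` for a set `R` of representatives of the
closed paths. -/
noncomputable def trClosed (T : TabSub A ι n s) (R : Finset (List (TabCell n))) : A :=
  ∏ l ∈ R, T.pathTr l

end TabSub

/-! ### Words in the free monoid `M_T` -/

/-- The transpose `uᵗ` of a word `u ∈ M_T` in the letters `1,…,s,1ᵗ,…,sᵗ`. -/
def wtp {s : ℕ} (w : List (Fin s × Bool)) : List (Fin s × Bool) :=
  (w.map fun p => (p.1, !p.2)).reverse

/-- Equality of words in `M_T` up to transposition (`=t`). -/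
def weqT {s : ℕ} (w w' : List (Fin s × Bool)) : Prop := w = w' ∨ w = wtp w'

/-- Equality of words in `M_T` up to cyclic permutation and transposition (`=ct`). -/
def weqCT {s : ℕ} (w w' : List (Fin s × Bool)) : Prop :=
  w.IsRotated w' ∨ w.IsRotated (wtp w')

/-- A word in a free monoid is primitive if it is not a power (with at least two
factors) of a word. -/
def PrimitiveWord {α : Type*} (w : List α) : Prop :=
  w ≠ [] ∧ ∀ (u : List α) (r : ℕ), 2 ≤ r → w ≠ (List.replicate r u).flatten

namespace TabSub

variable {A : Type} [CommRing A] {ι : Type} [Fintype ι] [DecidableEq ι] {n : ι → ℕ} {s : ℕ}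

/-! ### The tableau `T̃` -/

/-- The inclusion of the cells of the shape with the columns `q_1, q_2` deleted into the
cells of the original shape. -/
def embCell (q1 q2 : ι) (c : TabCell (fun i : {i : ι // i ≠ q1 ∧ i ≠ q2} => n i.1)) :
    TabCell n := ⟨c.1.1, c.2⟩

/-- The word in `M_T` corresponding to an arrow of `T̃` with tail cell `c'`: for an old
arrow (Case A) it is the single letter `φ(a)`; for an arrow coming from an open path
`l ∈ Ro` starting at `c'` (Case B) it is `φ(l)`. -/
noncomputable def tildeWord (T : TabSub A ι n s) (q1 q2 : ι)
    (Ro : Finset (List (TabCell n)))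
    (c' : TabCell (fun i : {i : ι // i ≠ q1 ∧ i ≠ q2} => n i.1)) : List (Fin s × Bool) :=
  if ((T.mate (embCell q1 q2 c')).1 ≠ q1 ∧ (T.mate (embCell q1 q2 c')).1 ≠ q2) then
    [T.letter (embCell q1 q2 c')]
  else
    T.word ((Ro.filter fun l => l.head? = some (embCell q1 q2 c')).toList.headI)

end TabSub

namespace TabSub

variable {A : Type} [CommRing A] {ι : Type} [Fintype ι] [DecidableEq ι] {n : ι → ℕ} {s : ℕ}

/-- `D` is (a tableau with substitution equal to) the tableau `T̃` associated with `T`,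
the columns `q_1, q_2`, and the set `Ro` of representatives of open paths.  Its arrows
are the arrows of `T` lying entirely outside the columns `q_1, q_2` (Case A, carrying
the same matrices), together with one arrow for each open path `l ∈ Ro`, going from the
tail of the first arrow of `l` to the head of its last arrow and carrying the matrix
`X_{φ(l)}` (Case B); two arrows of `D` carry the same label iff the corresponding words
in `M_T` coincide. -/
def IsTilde (T : TabSub A ι n s) (q1 q2 : ι) (Ro : Finset (List (TabCell n))) {t : ℕ}
    (D : TabSub A {i : ι // i ≠ q1 ∧ i ≠ q2} (fun i => n i.1) t) : Prop :=
  (∀ c' : TabCell (fun i : {i : ι // i ≠ q1 ∧ i ≠ q2} => n i.1),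
    ((T.mate (embCell q1 q2 c')).1 ≠ q1 ∧ (T.mate (embCell q1 q2 c')).1 ≠ q2) →
      D.isTail c' = T.isTail (embCell q1 q2 c') ∧
      embCell q1 q2 (D.mate c') = T.mate (embCell q1 q2 c') ∧
      ∀ i j, D.matOf c' i j = T.matOf (embCell q1 q2 c') i j) ∧
  (∀ l ∈ Ro, ∀ (h : l ≠ []) (h1 : (l.head h).1 ≠ q1 ∧ (l.head h).1 ≠ q2),
      D.isTail ⟨⟨(l.head h).1, h1⟩, (l.head h).2⟩ = true ∧
      embCell q1 q2 (D.mate ⟨⟨(l.head h).1, h1⟩, (l.head h).2⟩) = T.mate (l.getLast h) ∧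
      ∀ i j, D.matOf ⟨⟨(l.head h).1, h1⟩, (l.head h).2⟩ i j = T.pathMat l i j) ∧
  (∀ c' d', D.isTail c' = true → D.isTail d' = true →
      (D.lab c' = D.lab d' ↔ tildeWord T q1 q2 Ro c' = tildeWord T q1 q2 Ro d'))

end TabSub

/-! ### Quadruples and the sets `S_τ`, `S_{β,γ,b,c}` -/

/-- The data of a quadruple `(β,γ,b,c)` with `β ∈ ℕ^p`, `γ ∈ ℕ^q` and `b`, `c`
sequences of words in `M_T`. -/
structure QuadData (s : ℕ) where
  p : ℕ
  q : ℕ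
  β : Fin p → ℕ
  γ : Fin q → ℕ
  b : Fin p → List (Fin s × Bool)
  c : Fin q → List (Fin s × Bool)

namespace QuadData

variable {s : ℕ}

/-- `(β,γ,b,c)` is a `T`-quadruple: the `b_i`, `c_j` are primitive, the `b_i` are
pairwise different with respect to `=t` and the `c_j` pairwise different with respect
to `=ct`. -/
def IsQuad (Q : QuadData s) : Prop :=
  (∀ i, PrimitiveWord (Q.b i)) ∧ (∀ j, PrimitiveWord (Q.c j)) ∧
  (∀ i i', i ≠ i' → ¬ weqT (Q.b i) (Q.b i')) ∧
  (∀ j j', j ≠ j' → ¬ weqCT (Q.c j) (Q.c j'))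

/-- The multiset `{{b_1,…,b_1,…,b_p,…,b_p}}` with `b_i` of multiplicity `β_i`. -/
def mB (Q : QuadData s) : Multiset (List (Fin s × Bool)) :=
  ∑ i, Multiset.replicate (Q.β i) (Q.b i)

/-- The multiset `{{c_1,…,c_1,…,c_q,…,c_q}}` with `c_j` of multiplicity `γ_j`. -/
def mC (Q : QuadData s) : Multiset (List (Fin s × Bool)) :=
  ∑ j, Multiset.replicate (Q.γ j) (Q.c j)

/-- Equivalence of quadruples: the associated multisets agree up to `=t` (for `b`)
and up to `=ct` (for `c`). -/
def Equiv (Q Q' : QuadData s) : Prop :=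
  Multiset.Rel weqT Q.mB Q'.mB ∧ Multiset.Rel weqCT Q.mC Q'.mC

end QuadData

namespace TabSub

variable {A : Type} [CommRing A] {ι : Type} [Fintype ι] [DecidableEq ι] {n : ι → ℕ} {s : ℕ}

/-- The multiset `φ(T_o)` (or `φ(T_cl)`) of words in `M_T` of a set `R` of
representative paths. -/
def wordsOf (T : TabSub A ι n s) (R : Finset (List (TabCell n))) :
    Multiset (List (Fin s × Bool)) :=
  R.val.map T.word

/-- `ξ` witnesses the `T`-admissibility of the quadruple `Q`, with respect to the given
families `Ro ξ`, `Rcl ξ` of representatives of the open and closed paths of `T^ξ`: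
`φ(T^ξ_o) =t {{b_i with multiplicity β_i}}` and
`φ(T^ξ_cl) =ct {{c_j with multiplicity γ_j}}`. -/
def Witness (T : TabSub A ι n s) (q1 q2 : ι)
    (Ro Rcl : Finset (List (TabCell n))) (Q : QuadData s) : Prop :=
  Multiset.Rel weqT (T.wordsOf Ro) Q.mB ∧ Multiset.Rel weqCT (T.wordsOf Rcl) Q.mC

/-- The quadruple `Q` is `T`-admissible. -/
def Admissible (T : TabSub A ι n s) (q1 q2 : ι) (hn : n q1 = n q2)
    (Ro Rcl : Equiv.Perm (Fin (n q2)) → Finset (List (TabCell n)))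
    (Q : QuadData s) : Prop :=
  Q.IsQuad ∧ ∃ ξ : Equiv.Perm (Fin (n q2)), Witness (T.tw q2 ξ) q1 q2 (Ro ξ) (Rcl ξ) Q

/-- Membership `τ ∈ S_{β,γ,b,c}`: `φ(T^τ_o) =t {{b_i with multiplicity β_i}}` and
`φ(T^τ_cl) =ct {{c_1^{λ_{11}},…,c_1^{λ_{1l_1}},…,c_q^{λ_{q1}},…,c_q^{λ_{ql_q}}}}` for
some positive integers `λ_{ij}` with `λ_{i1}+⋯+λ_{il_i} = γ_i`. -/
def SQuadMem (T : TabSub A ι n s) (q1 q2 : ι)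
    (Ro Rcl : Equiv.Perm (Fin (n q2)) → Finset (List (TabCell n)))
    (Q : QuadData s) (τ : Equiv.Perm (Fin (n q2))) : Prop :=
  Multiset.Rel weqT ((T.tw q2 τ).wordsOf (Ro τ)) Q.mB ∧
  ∃ L : Fin Q.q → Multiset ℕ,
    (∀ j, (∀ x ∈ L j, 0 < x) ∧ (L j).sum = Q.γ j) ∧
    Multiset.Rel weqCT ((T.tw q2 τ).wordsOf (Rcl τ))
      (∑ j, (L j).map fun lam => (List.replicate lam (Q.c j)).flatten)

/-- The set `S_τ` of permutations `π` with `φ(T^π_o) =t φ(T^τ_o)` and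
`φ(T^π_cl) =ct φ(T^τ_cl)`. -/
def SPerm (T : TabSub A ι n s) (q1 q2 : ι)
    (Ro Rcl : Equiv.Perm (Fin (n q2)) → Finset (List (TabCell n)))
    (τ : Equiv.Perm (Fin (n q2))) : Set (Equiv.Perm (Fin (n q2))) :=
  {π | Multiset.Rel weqT ((T.tw q2 π).wordsOf (Ro π)) ((T.tw q2 τ).wordsOf (Ro τ)) ∧
       Multiset.Rel weqCT ((T.tw q2 π).wordsOf (Rcl π)) ((T.tw q2 τ).wordsOf (Rcl τ))}

/-! ### Auxiliary constructions for Lemmas about `T^π` -/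

/-- The word of arrows of `T` underlying a word of arrows of `T^τ`. -/
def underlying (T : TabSub A ι n s) (q2 : ι) (τ : Equiv.Perm (Fin (n q2)))
    (l : List (TabCell n)) : List (TabCell n) :=
  l.map (colPerm n q2 τ).symm

/-- The cell number of a cell lying in column `q_1` or `q_2`, as an element of
`Fin (n q2)` (using `n q1 = n q2`). -/
def toQ2 {q1 q2 : ι} (hn : n q1 = n q2) (c : TabCell n) (h : c.1 = q1 ∨ c.1 = q2) :
    Fin (n q2) :=
  if h2 : c.1 = q2 then Fin.cast (congrArg n h2) c.2
  else Fin.cast ((congrArg n (h.resolve_right h2)).trans hn) c.2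

/-- The substitution `a → b, b → a` on oriented arrows (hence also `aᵗ → bᵗ, bᵗ → aᵗ`). -/
def swapSub (T : TabSub A ι n s) (a b : TabCell n) (c : TabCell n) : TabCell n :=
  if c = a then b else if c = b then a
  else if c = T.mate a then T.mate b else if c = T.mate b then T.mate a else c

end TabSub

namespace BW

variable {C : Type} (M γ : C → C)

/-- Consecutive letters of a path. -/
def Chn (l : List C) : Prop :=
  ∀ i (h : i + 1 < l.length), l[i+1] = γ (M l[i]) ∧ γ l[i+1] ≠ l[i+1]

structure Opn (l : List C) : Prop where
  chain : Chn M γ l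
  nodup : l.Nodup
  two : 2 ≤ l.length
  hd : ∀ h : 0 < l.length, γ l[0] = l[0]
  lst : ∀ h : l.length - 1 < l.length, γ (M l[l.length - 1]) = M l[l.length - 1]

structure Cls (l : List C) : Prop where
  chain : Chn M γ l
  nodup : l.Nodup
  pos : 0 < l.length
  cl : ∀ (h : 0 < l.length) (h' : l.length - 1 < l.length),
    l[0] = γ (M l[l.length - 1]) ∧ γ l[0] ≠ l[0]

def rv (l : List C) : List C := (l.map M).reverse

variable {M γ}

theorem rv_length (l : List C) : (rv M l).length = l.length := by simp [rv]

theorem rv_getElem (l : List C) (i : ℕ) (h : i < (rv M l).length) :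
    (rv M l)[i] = M (l[l.length - 1 - i]'(by rw [rv_length] at h; omega)) := by
  simp [rv]

theorem rv_rv (hM : ∀ c, M (M c) = c) (l : List C) : rv M (rv M l) = l := by
  simp [rv, List.map_reverse, Function.comp_def, hM]

theorem mem_rv (hM : ∀ c, M (M c) = c) (l : List C) (x : C) : x ∈ rv M l ↔ M x ∈ l := by
  simp only [rv, List.mem_reverse, List.mem_map]
  constructor
  · rintro ⟨a, ha, rfl⟩; rwa [hM]
  · intro h; exact ⟨_, h, hM x⟩

theorem gidx {l : List C} {i j : ℕ} (hi : i < l.length) (h : i = j) :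
    l[i] = l[j]'(h ▸ hi) := by subst h; rfl

theorem Chn.rv (hM : ∀ c, M (M c) = c) (hγ : ∀ c, γ (γ c) = c) {l : List C}
    (h : Chn M γ l) : Chn M γ (rv M l) := by
  intro i hi
  have hlen := rv_length (M := M) l
  rw [rv_getElem, rv_getElem, hM]
  have h1 := h (l.length - 1 - (i+1)) (by omega)
  have e : l.length - 1 - (i+1) + 1 = l.length - 1 - i := by omega
  simp only [e] at h1
  constructor
  · rw [h1.1, hγ]
  · intro h2
    apply h1.2
    have h3 := h1.1
    rw [h3, hγ]; exact h2.symm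

theorem nodup_rv (hM : ∀ c, M (M c) = c) {l : List C} (h : l.Nodup) : (rv M l).Nodup := by
  unfold rv
  rw [List.nodup_reverse]
  exact h.map (Function.LeftInverse.injective hM)

theorem Opn.rv (hM : ∀ c, M (M c) = c) (hγ : ∀ c, γ (γ c) = c) {l : List C}
    (h : Opn M γ l) : Opn M γ (rv M l) := by
  have hlen := rv_length (M := M) l
  have h2 := h.two
  refine ⟨h.chain.rv hM hγ, nodup_rv hM h.nodup, by omega, ?_, ?_⟩
  · intro h0
    rw [rv_getElem]
    exact h.lst (by omega)
  · intro h0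
    rw [rv_getElem, hM]
    have e : l.length - 1 - ((BW.rv M l).length - 1) = 0 := by omega
    simp only [e]
    exact h.hd (by omega)

theorem Cls.rv (hM : ∀ c, M (M c) = c) (hγ : ∀ c, γ (γ c) = c) {l : List C}
    (h : Cls M γ l) : Cls M γ (rv M l) := by
  have hlen := rv_length (M := M) l
  have h2 := h.pos
  refine ⟨h.chain.rv hM hγ, nodup_rv hM h.nodup, by omega, ?_⟩
  intro h0 h0'
  rw [rv_getElem, rv_getElem, hM]
  have e : l.length - 1 - ((BW.rv M l).length - 1) = 0 := by omega
  have e' : l.length - 1 - 0 = l.length - 1 := by omega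
  simp only [e, e']
  obtain ⟨h3, h4⟩ := h.cl (by omega) (by omega)
  constructor
  · rw [h3, hγ]
  · intro h5
    apply h4
    rw [h3, hγ]; exact h5.symm

theorem noflip_aux (hM : ∀ c, M (M c) = c) (hMne : ∀ c, M c ≠ c)
    (hγ : ∀ c, γ (γ c) = c) {l : List C} (h : Chn M γ l) :
    ∀ (d j : ℕ) (hj : j + d < l.length), l[j + d] ≠ M (l[j]'(by omega)) := by
  intro d
  induction d using Nat.strong_induction_on with
  | _ d ih =>
    intro j hj he
    match d, ih, hj, he with
    | 0, _, hj, he => exact hMne _ he.symm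
    | 1, _, hj, he =>
      obtain ⟨h1, h2⟩ := h j hj
      apply h2
      rw [he] at h1 ⊢
      exact h1.symm
    | d + 2, ih, hj, he =>
      obtain ⟨h1, h2⟩ := h (j + d + 1) (by omega)
      obtain ⟨h3, h4⟩ := h j (by omega)
      have e : j + (d + 2) = j + d + 1 + 1 := by omega
      simp only [e] at he
      rw [he] at h1
      apply ih d (by omega) (j + 1) (by omega)
      have e2 : j + 1 + d = j + d + 1 := by omega
      simp only [e2]
      rw [h3, h1, hγ, hM]

theorem noflip (hM : ∀ c, M (M c) = c) (hMne : ∀ c, M c ≠ c)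
    (hγ : ∀ c, γ (γ c) = c) {l : List C} (h : Chn M γ l) {x : C} (h1 : x ∈ l)
    (h2 : M x ∈ l) : False := by
  obtain ⟨j, hj, rfl⟩ := List.getElem_of_mem h1
  obtain ⟨k, hk, hk'⟩ := List.getElem_of_mem h2
  rcases le_total j k with hjk | hjk
  · obtain ⟨d, rfl⟩ := Nat.exists_eq_add_of_le hjk
    exact noflip_aux hM hMne hγ h d j hk hk'
  · obtain ⟨d, rfl⟩ := Nat.exists_eq_add_of_le hjk
    exact noflip_aux hM hMne hγ h d k hj (by rw [hk', hM])

theorem f_inj (hM : ∀ c, M (M c) = c) (hγ : ∀ c, γ (γ c) = c) {x y : C}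
    (h : γ (M x) = γ (M y)) : x = y := by
  rw [← hM x, ← hγ (M x), h, hγ, hM]

theorem opn_back (hM : ∀ c, M (M c) = c) (hγ : ∀ c, γ (γ c) = c) {l1 l2 : List C}
    (h1 : Opn M γ l1) (h2 : Opn M γ l2) : ∀ (j k : ℕ) (hj : j < l1.length) (hk : k < l2.length),
    l1[j] = l2[k] → l1[0]'(by omega) = l2[0]'(by omega) := by
  intro j
  induction j with
  | zero =>
    intro k hj hk he
    cases k with
    | zero => exact he
    | succ k =>
      exfalso
      apply (h2.chain k hk).2
      rw [← he]; exact h1.hd _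
  | succ j ih =>
    intro k hj hk he
    cases k with
    | zero =>
      exfalso
      apply (h1.chain j hj).2
      rw [he]; exact h2.hd _
    | succ k =>
      apply ih k (by omega) (by omega)
      apply f_inj hM hγ
      rw [← (h1.chain j hj).1, ← (h2.chain k hk).1, he]

theorem opn_fwd {l1 l2 : List C}
    (h1 : Chn M γ l1) (h2 : Chn M γ l2) (p1 : 0 < l1.length) (p2 : 0 < l2.length)
    (h0 : l1[0] = l2[0]) : ∀ (j : ℕ) (hj : j < l1.length) (hk : j < l2.length),
    l1[j] = l2[j] := by
  intro j
  induction j with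
  | zero => intro _ _; exact h0
  | succ j ih =>
    intro hj hk
    rw [(h1 j hj).1, (h2 j hk).1, ih]

theorem opn_len {l1 l2 : List C}
    (h1 : Opn M γ l1) (h2 : Opn M γ l2) (p1 : 0 < l1.length) (p2 : 0 < l2.length)
    (h0 : l1[0] = l2[0]) : l2.length ≤ l1.length := by
  by_contra hlt
  push Not at hlt
  have e := opn_fwd h1.chain h2.chain p1 p2 h0 (l1.length - 1) (by omega) (by omega)
  have h3 := h1.lst (by omega)
  obtain ⟨h4, h5⟩ := h2.chain (l1.length - 1) (by omega)
  rw [h4, ← e, h3] at h5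
  exact h5 h3

theorem opn_share (hM : ∀ c, M (M c) = c) (hγ : ∀ c, γ (γ c) = c) {l1 l2 : List C}
    (h1 : Opn M γ l1) (h2 : Opn M γ l2) {x : C} (hx1 : x ∈ l1) (hx2 : x ∈ l2) : l1 = l2 := by
  obtain ⟨j, hj, rfl⟩ := List.getElem_of_mem hx1
  obtain ⟨k, hk, hk'⟩ := List.getElem_of_mem hx2
  have h0 := opn_back hM hγ h1 h2 j k hj hk hk'.symm
  have p1 : 0 < l1.length := by omega
  have p2 : 0 < l2.length := by omega
  apply List.ext_getElem
  · exact le_antisymm (opn_len h2 h1 p2 p1 h0.symm) (opn_len h1 h2 p1 p2 h0)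
  · exact opn_fwd h1.chain h2.chain p1 p2 h0

theorem Cls.ne {l : List C} (h : Cls M γ l) {x : C} (hx : x ∈ l) : γ x ≠ x := by
  obtain ⟨j, hj, rfl⟩ := List.getElem_of_mem hx
  cases j with
  | zero => exact (h.cl (by omega) (by omega)).2
  | succ j => exact (h.chain j hj).2

theorem Cls.pred {l : List C} (h : Cls M γ l) {x : C} (hx : x ∈ l) :
    ∃ y ∈ l, x = γ (M y) := by
  obtain ⟨j, hj, rfl⟩ := List.getElem_of_mem hx
  cases j with
  | zero => exact ⟨_, List.getElem_mem _, (h.cl (by omega) (by omega)).1⟩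
  | succ j => exact ⟨_, List.getElem_mem _, (h.chain j hj).1⟩

theorem Cls.next {l : List C} (h : Cls M γ l) {x : C} (hx : x ∈ l) :
    γ (M x) ∈ l := by
  obtain ⟨j, hj, rfl⟩ := List.getElem_of_mem hx
  by_cases hj' : j + 1 < l.length
  · rw [← (h.chain j hj').1]; exact List.getElem_mem _
  · have e : j = l.length - 1 := by omega
    subst e
    rw [← (h.cl (by omega) (by omega)).1]; exact List.getElem_mem _

theorem opn_cls (hM : ∀ c, M (M c) = c) (hγ : ∀ c, γ (γ c) = c) {l1 l2 : List C}
    (h1 : Opn M γ l1) (h2 : Cls M γ l2) {x : C} (hx1 : x ∈ l1) (hx2 : x ∈ l2) : False := by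
  obtain ⟨j, hj, rfl⟩ := List.getElem_of_mem hx1
  clear hx1
  induction j with
  | zero => exact h2.ne hx2 (h1.hd _)
  | succ j ih =>
    obtain ⟨y, hy, e⟩ := h2.pred hx2
    rw [(h1.chain j hj).1] at e
    have := f_inj hM hγ e
    exact ih (by omega) (by rwa [this])

theorem cls_orbit {l : List C} (h : Cls M γ l) (hp : 0 < l.length) :
    (l : Cycle C) = Function.periodicOrbit (γ ∘ M) l[0] ∧
    l[0] ∈ Function.periodicPts (γ ∘ M) ∧
    ∀ (i : ℕ) (hi : i < l.length), l[i] = (γ ∘ M)^[i] l[0] := by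
  have h1 : ∀ (i : ℕ) (hi : i < l.length), l[i] = (γ ∘ M)^[i] l[0] := by
    intro i
    induction i with
    | zero => intro _; rfl
    | succ i ih =>
      intro hi
      rw [(h.chain i hi).1, ih (by omega), Function.iterate_succ_apply']; rfl
  have h2 : Function.IsPeriodicPt (γ ∘ M) l.length l[0] := by
    have e : l.length = (l.length - 1) + 1 := by omega
    unfold Function.IsPeriodicPt Function.IsFixedPt
    conv_lhs => rw [e]
    rw [Function.iterate_succ_apply', ← h1 _ (by omega)]
    exact (h.cl (by omega) (by omega)).1.symm
  have h3 : l[0] ∈ Function.periodicPts (γ ∘ M) := Function.mk_mem_periodicPts hp h2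
  have h4 : Function.minimalPeriod (γ ∘ M) l[0] = l.length := by
    apply le_antisymm (h2.minimalPeriod_le hp)
    by_contra hlt
    push Not at hlt
    have h5 := h1 _ hlt
    rw [Function.iterate_minimalPeriod] at h5
    have := (h.nodup.getElem_inj_iff).1 h5
    have := Function.minimalPeriod_pos_of_mem_periodicPts h3
    omega
  refine ⟨?_, h3, h1⟩
  rw [Function.periodicOrbit_def, h4]
  congr 1
  apply List.ext_getElem
  · simp
  · intro i hi _
    simp [h1 i hi]

theorem cls_share {l1 l2 : List C}
    (h1 : Cls M γ l1) (h2 : Cls M γ l2) {x : C} (hx1 : x ∈ l1) (hx2 : x ∈ l2) :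
    l1.IsRotated l2 := by
  have key : ∀ l : List C, Cls M γ l → x ∈ l →
      (l : Cycle C) = Function.periodicOrbit (γ ∘ M) x := by
    intro l h hx
    obtain ⟨a, b, c⟩ := cls_orbit h h.pos
    obtain ⟨j, hj, rfl⟩ := List.getElem_of_mem hx
    rw [c j hj, Function.periodicOrbit_apply_iterate_eq b, a]
  exact Cycle.coe_eq_coe.1 ((key l1 h1 hx1).trans (key l2 h2 hx2).symm)

theorem exists_path [Finite C] (hM : ∀ c, M (M c) = c) (hγ : ∀ c, γ (γ c) = c) (x : C)
    (hx : γ x ≠ x ∨ γ (M x) ≠ M x) : ∃ l, x ∈ l ∧ (Opn M γ l ∨ Cls M γ l) := by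
  have finj : Function.Injective (γ ∘ M) := fun a b h => f_inj hM hγ h
  set f := γ ∘ M with hf
  have per : ∀ y, y ∈ Function.periodicPts f := fun y => finj.mem_periodicPts y
  by_cases hall : ∀ k, γ (f^[k] x) ≠ f^[k] x
  · set p := Function.minimalPeriod f x with hp
    have hp0 : 0 < p := Function.minimalPeriod_pos_of_mem_periodicPts (per x)
    refine ⟨(List.range p).map fun k => f^[k] x, ?_, Or.inr ⟨?_, ?_, ?_, ?_⟩⟩
    · rw [List.mem_map]; exact ⟨0, by simpa using hp0, rfl⟩
    · intro i hi
      simp only [List.getElem_map, List.getElem_range]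
      exact ⟨Function.iterate_succ_apply' f i x, hall _⟩
    · rw [List.nodup_map_iff_inj_on List.nodup_range]
      intro a ha b hb hab
      exact Function.iterate_injOn_Iio_minimalPeriod (by simpa using ha) (by simpa using hb) hab
    · simpa using hp0
    · intro h h'
      simp only [List.getElem_map, List.getElem_range, List.length_map, List.length_range]
      refine ⟨?_, hall _⟩
      have := Function.iterate_succ_apply' f (p - 1) x
      rw [show (p - 1).succ = p by omega, Function.iterate_minimalPeriod] at this
      exact this
  · push Not at hall
    obtain ⟨a, ha⟩ := hall
    classical
    have hex : ∃ k, ∃ y, γ y = y ∧ f^[k] y = x := by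
      obtain ⟨N, hN, hN'⟩ := Function.mem_periodicPts.1 (per x)
      refine ⟨N * a - a, f^[a] x, ha, ?_⟩
      rw [← Function.iterate_add_apply, Nat.sub_add_cancel (Nat.le_mul_of_pos_left a hN)]
      exact hN'.mul_const a
    obtain ⟨y, hy, hyx⟩ := Nat.find_spec hex
    have hmin := fun m => @Nat.find_min _ _ hex m
    set k := Nat.find hex with hk
    clear_value k
    have hQ : ∀ i, 0 < i → i ≤ k → γ (f^[i] y) ≠ f^[i] y := by
      intro i hi hik h
      apply hmin (k - i) (by omega)
      refine ⟨_, h, ?_⟩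
      rw [← Function.iterate_add_apply, Nat.sub_add_cancel hik, hyx]
    have hback : ∀ i, γ (f^[i+1] y) = f^[i+1] y ↔ γ (M (f^[i] y)) = M (f^[i] y) := by
      intro i
      rw [Function.iterate_succ_apply']
      simp only [hf, Function.comp_apply, hγ]
      exact ⟨fun h => h.symm, fun h => h.symm⟩
    have hex2 : ∃ j, γ (M (f^[j] y)) = M (f^[j] y) := by
      obtain ⟨N, hN, hN'⟩ := Function.mem_periodicPts.1 (per y)
      refine ⟨N - 1, (hback _).1 ?_⟩
      rw [Nat.sub_add_cancel hN, hN'.eq, hy]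
    have hj := Nat.find_spec hex2
    have hjmin := fun m => @Nat.find_min _ _ hex2 m
    set j := Nat.find hex2 with hjd
    clear_value j
    have hkj : k ≤ j := by
      by_contra hlt
      push Not at hlt
      exact hQ (j+1) (by omega) hlt ((hback j).2 hj)
    have hj1 : 1 ≤ j := by
      by_contra hlt
      have hj0 : j = 0 := by omega
      have hk0 : k = 0 := by omega
      subst hj0 hk0
      simp only [Function.iterate_zero, id_eq] at hyx hj
      subst hyx
      rcases hx with h | h
      · exact h hy
      · exact h hj
    have hstep : ∀ i, 0 < i → i ≤ j → γ (f^[i] y) ≠ f^[i] y := by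
      intro i hi hij h
      obtain ⟨i, rfl⟩ : ∃ i', i = i' + 1 := ⟨i - 1, by omega⟩
      exact hjmin i (by omega) ((hback i).1 h)
    refine ⟨(List.range (j+1)).map fun k => f^[k] y, ?_, Or.inl ⟨?_, ?_, ?_, ?_, ?_⟩⟩
    · rw [List.mem_map]; exact ⟨k, by simpa using (by omega), hyx⟩
    · intro i hi
      simp only [List.length_map, List.length_range] at hi
      simp only [List.getElem_map, List.getElem_range]
      exact ⟨Function.iterate_succ_apply' f i y, hstep _ (by omega) (by omega)⟩
    · rw [List.nodup_map_iff_inj_on List.nodup_range]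
      have main : ∀ a b, a < b → b ≤ j → f^[a] y ≠ f^[b] y := by
        intro a b hab hb h
        have : f^[a] y = f^[a] (f^[b-a] y) := by
          rw [← Function.iterate_add_apply, Nat.add_sub_cancel' hab.le, h]
        have h2 := finj.iterate a this
        apply hstep (b - a) (by omega) (by omega)
        rw [← h2, hy]
      intro a ha b hb hab
      simp only [List.mem_range] at ha hb
      rcases lt_trichotomy a b with h | h | h
      · exact absurd hab (main a b h (by omega))
      · exact h
      · exact absurd hab.symm (main b a h (by omega))
    · simpa using hj1
    · intro h
      simpa using hy
    · intro h
      simp only [List.getElem_map, List.getElem_range, List.length_map, List.length_range,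
        Nat.add_sub_cancel]
      exact hj

end BW

namespace BW

variable {C : Type} {M γ : C → C}

/-- The arrow of `x` occurs in `l` in one of its orientations. -/
def Tch (M : C → C) (x : C) (l : List C) : Prop := x ∈ l ∨ M x ∈ l

theorem Tch.rv (hM : ∀ c, M (M c) = c) {x : C} {l : List C} :
    Tch M x (rv M l) ↔ Tch M x l := by
  simp only [Tch, mem_rv hM, hM]
  exact or_comm

theorem Tch.rot {x : C} {l l' : List C} (h : l.IsRotated l') :
    Tch M x l ↔ Tch M x l' := by
  simp only [Tch, h.mem_iff]

theorem rot_rv {l l' : List C} (h : l.IsRotated l') : (rv M l).IsRotated (rv M l') :=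
  (h.map M).reverse

theorem Opn.touch (hγ : ∀ c, γ (γ c) = c) {l : List C} (h : Opn M γ l) {x : C} (hx : x ∈ l) :
    γ x ≠ x ∨ γ (M x) ≠ M x := by
  obtain ⟨j, hj, rfl⟩ := List.getElem_of_mem hx
  cases j with
  | zero =>
    right
    obtain ⟨h1, h2⟩ := h.chain 0 (by have := h.two; omega)
    intro h3
    rw [h1, h3] at h2
    exact h2 h3
  | succ j => exact Or.inl (h.chain j hj).2

structure Reps (M γ : C → C) (Ro Rc : Set (List C)) : Prop where
  o1 : ∀ l ∈ Ro, Opn M γ l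
  c1 : ∀ l ∈ Rc, Cls M γ l
  o2 : ∀ l, Opn M γ l → ∃! l', l' ∈ Ro ∧ (l = l' ∨ l = rv M l')
  c2 : ∀ l, Cls M γ l → ∃! l', l' ∈ Rc ∧ (l.IsRotated l' ∨ l.IsRotated (rv M l'))

theorem Reps.cover [Finite C] {Ro Rc : Set (List C)} (H : Reps M γ Ro Rc)
    (hM : ∀ c, M (M c) = c) (hγ : ∀ c, γ (γ c) = c) (x : C)
    (hx : γ x ≠ x ∨ γ (M x) ≠ M x) : ∃ l, (l ∈ Ro ∨ l ∈ Rc) ∧ Tch M x l := by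
  obtain ⟨l, hxl, hl | hl⟩ := exists_path hM hγ x hx
  · obtain ⟨l', ⟨h1, h2⟩, -⟩ := H.o2 l hl
    refine ⟨l', Or.inl h1, ?_⟩
    rcases h2 with rfl | rfl
    · exact Or.inl hxl
    · exact (Tch.rv hM).1 (Or.inl hxl)
  · obtain ⟨l', ⟨h1, h2⟩, -⟩ := H.c2 l hl
    refine ⟨l', Or.inr h1, ?_⟩
    rcases h2 with h2 | h2
    · exact (Tch.rot h2).1 (Or.inl hxl)
    · exact (Tch.rv hM).1 ((Tch.rot h2).1 (Or.inl hxl))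

theorem Reps.sep {Ro Rc : Set (List C)} (H : Reps M γ Ro Rc)
    (hM : ∀ c, M (M c) = c) (hγ : ∀ c, γ (γ c) = c) (x : C) {l l' : List C}
    (hl : l ∈ Ro ∨ l ∈ Rc) (hl' : l' ∈ Ro ∨ l' ∈ Rc) (h : Tch M x l) (h' : Tch M x l') :
    l = l' := by
  have oc : ∀ l l', l ∈ Ro → l' ∈ Rc → Tch M x l → Tch M x l' → False := by
    intro l l' hl hl' h h'
    have a1 := H.o1 l hl
    have a2 := H.c1 l' hl'
    rcases h with h | h <;> rcases h' with h' | h'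
    · exact opn_cls hM hγ a1 a2 h h'
    · exact opn_cls hM hγ a1 (a2.rv hM hγ) h ((mem_rv hM _ _).2 h')
    · exact opn_cls hM hγ a1 (a2.rv hM hγ) h ((mem_rv hM _ _).2 (by rwa [hM]))
    · exact opn_cls hM hγ a1 a2 h h'
  rcases hl with hl | hl <;> rcases hl' with hl' | hl'
  · have a1 := H.o1 l hl
    have a2 := H.o1 l' hl'
    have key : l = l' ∨ l = BW.rv M l' := by
      rcases h with h | h <;> rcases h' with h' | h'
      · exact Or.inl (opn_share hM hγ a1 a2 h h')
      · exact Or.inr (opn_share hM hγ a1 (a2.rv hM hγ) h ((mem_rv hM _ _).2 h'))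
      · exact Or.inr (opn_share hM hγ a1 (a2.rv hM hγ) h ((mem_rv hM _ _).2 (by rwa [hM])))
      · exact Or.inl (opn_share hM hγ a1 a2 h h')
    exact (H.o2 l a1).unique ⟨hl, Or.inl rfl⟩ ⟨hl', key⟩
  · exact (oc l l' hl hl' h h').elim
  · exact (oc l' l hl' hl h' h).elim
  · have a1 := H.c1 l hl
    have a2 := H.c1 l' hl'
    have key : l.IsRotated l' ∨ l.IsRotated (BW.rv M l') := by
      rcases h with h | h <;> rcases h' with h' | h'
      · exact Or.inl (cls_share a1 a2 h h')
      · exact Or.inr (cls_share a1 (a2.rv hM hγ) h ((mem_rv hM _ _).2 h'))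
      · exact Or.inr (cls_share a1 (a2.rv hM hγ) h ((mem_rv hM _ _).2 (by rwa [hM])))
      · exact Or.inl (cls_share a1 a2 h h')
    exact (H.c2 l a1).unique ⟨hl, Or.inl (List.IsRotated.refl _)⟩ ⟨hl', key⟩

/-- One side of a system of matched paths. -/
structure Side (M γ : C → C) {I : Type} (P : I → List C) (op : I → Prop) : Prop where
  o : ∀ i, op i → Opn M γ (P i)
  c : ∀ i, ¬ op i → Cls M γ (P i)
  cover : ∀ x, (γ x ≠ x ∨ γ (M x) ≠ M x) → ∃ i, Tch M x (P i)
  sep : ∀ x i j, Tch M x (P i) → Tch M x (P j) → i = j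

theorem Side.chain {I : Type} {P : I → List C} {op : I → Prop} (H : Side M γ P op) (i : I) :
    Chn M γ (P i) := by
  by_cases h : op i
  · exact (H.o i h).chain
  · exact (H.c i h).chain

theorem Side.nodup {I : Type} {P : I → List C} {op : I → Prop} (H : Side M γ P op) (i : I) :
    (P i).Nodup := by
  by_cases h : op i
  · exact (H.o i h).nodup
  · exact (H.c i h).nodup

theorem Side.touch {I : Type} {P : I → List C} {op : I → Prop} (H : Side M γ P op) 
    (hγ : ∀ c, γ (γ c) = c) {i : I}
    {x : C} (hx : x ∈ P i) : γ x ≠ x ∨ γ (M x) ≠ M x := by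
  by_cases h : op i
  · exact (H.o i h).touch hγ hx
  · exact Or.inl ((H.c i h).ne hx)

/-- The matching relation between cells. -/
def R (M M' γ : C → C) {I : Type} (P P' : I → List C) (c d : C) : Prop :=
  (γ c = c ∧ γ (M c) = M c ∧ d = c) ∨
  ∃ i k, ∃ (h : k < (P i).length) (h' : k < (P' i).length),
    (c = (P i)[k] ∧ d = (P' i)[k]) ∨ (c = M (P i)[k] ∧ d = M' (P' i)[k])

variable {M' : C → C} {I : Type} {P P' : I → List C} {op : I → Prop}

theorem R.total (hM : ∀ c, M (M c) = c) (H : Side M γ P op)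
    (hlen : ∀ i, (P i).length = (P' i).length) (c : C) : ∃ d, R M M' γ P P' c d := by
  by_cases hc : γ c ≠ c ∨ γ (M c) ≠ M c
  · obtain ⟨i, h | h⟩ := H.cover c hc
    · obtain ⟨j, hj, rfl⟩ := List.getElem_of_mem h
      exact ⟨_, Or.inr ⟨i, j, hj, (hlen i) ▸ hj, Or.inl ⟨rfl, rfl⟩⟩⟩
    · obtain ⟨j, hj, he⟩ := List.getElem_of_mem h
      exact ⟨_, Or.inr ⟨i, j, hj, (hlen i) ▸ hj, Or.inr ⟨by rw [he, hM], rfl⟩⟩⟩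
  · push Not at hc
    exact ⟨c, Or.inl ⟨hc.1, hc.2, rfl⟩⟩

theorem R.func (hM : ∀ c, M (M c) = c) (hMne : ∀ c, M c ≠ c) (hγ : ∀ c, γ (γ c) = c)
    (H : Side M γ P op) {c d e : C} (h1 : R M M' γ P P' c d) (h2 : R M M' γ P P' c e) :
    d = e := by
  have tM : ∀ c, (γ (M c) ≠ M c ∨ γ (M (M c)) ≠ M (M c)) ↔ (γ c ≠ c ∨ γ (M c) ≠ M c) := by
    intro c; rw [hM]; exact or_comm
  rcases h1 with ⟨a1, a2, rfl⟩ | ⟨i, k, hk, hk', h1⟩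
  · rcases h2 with ⟨b1, b2, rfl⟩ | ⟨j, l, hl, hl', h2⟩
    · rfl
    · exfalso
      have ht := H.touch hγ (List.getElem_mem hl)
      rcases h2 with ⟨rfl, -⟩ | ⟨rfl, -⟩
      · tauto
      · rw [← tM] at ht; tauto
  · rcases h2 with ⟨a1, a2, rfl⟩ | ⟨j, l, hl, hl', h2⟩
    · exfalso
      have ht := H.touch hγ (List.getElem_mem hk)
      rcases h1 with ⟨rfl, -⟩ | ⟨rfl, -⟩
      · tauto
      · rw [← tM] at ht; tauto
    · have t1 : Tch M c (P i) := by
        rcases h1 with ⟨rfl, -⟩ | ⟨rfl, -⟩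
        · exact Or.inl (List.getElem_mem hk)
        · right; rw [hM]; exact List.getElem_mem hk
      have t2 : Tch M c (P j) := by
        rcases h2 with ⟨rfl, -⟩ | ⟨rfl, -⟩
        · exact Or.inl (List.getElem_mem hl)
        · right; rw [hM]; exact List.getElem_mem hl
      obtain rfl := H.sep c i j t1 t2
      have nf : ∀ a b (ha : a < (P i).length) (hb : b < (P i).length),
          (P i)[a] ≠ M (P i)[b] := by
        intro a b ha hb he
        exact noflip hM hMne hγ (H.chain i) (List.getElem_mem hb) (he ▸ List.getElem_mem ha)
      rcases h1 with ⟨e1, rfl⟩ | ⟨e1, rfl⟩ <;> rcases h2 with ⟨e2, rfl⟩ | ⟨e2, rfl⟩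
      · have := (H.nodup i).getElem_inj_iff.1 (e1.symm.trans e2)
        subst this; rfl
      · exact (nf _ _ _ _ (e1.symm.trans e2)).elim
      · exact (nf _ _ _ _ (e2.symm.trans e1)).elim
      · have e3 : (P i)[k] = (P i)[l] := by rw [← hM (P i)[k], ← e1, e2, hM]
        have := (H.nodup i).getElem_inj_iff.1 e3
        subst this; rfl

theorem R.mate (hM : ∀ c, M (M c) = c) (hM' : ∀ c, M' (M' c) = c)
    (hA : ∀ c, γ c = c → γ (M c) = M c → M' c = M c) {c d : C}
    (h : R M M' γ P P' c d) : R M M' γ P P' (M c) (M' d) := by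
  rcases h with ⟨h1, h2, rfl⟩ | ⟨i, k, hk, hk', ⟨rfl, rfl⟩ | ⟨rfl, rfl⟩⟩
  · exact Or.inl ⟨h2, by rw [hM]; exact h1, hA _ h1 h2⟩
  · exact Or.inr ⟨i, k, hk, hk', Or.inr ⟨rfl, rfl⟩⟩
  · exact Or.inr ⟨i, k, hk, hk', Or.inl ⟨by rw [hM], by rw [hM']⟩⟩

theorem R.glue (hγ : ∀ c, γ (γ c) = c) (H : Side M γ P op) (H' : Side M' γ P' op)
    (hlen : ∀ i, (P i).length = (P' i).length) {c d : C}
    (h : R M M' γ P P' c d) : R M M' γ P P' (γ c) (γ d) := by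
  rcases h with ⟨h1, h2, rfl⟩ | ⟨i, k, hk, hk', ⟨rfl, rfl⟩ | ⟨rfl, rfl⟩⟩
  · exact Or.inl ⟨by rw [h1, h1], by rw [h1, h2], rfl⟩
  · cases k with
    | zero =>
      by_cases ho : op i
      · rw [(H.o i ho).hd hk, (H'.o i ho).hd hk']
        exact Or.inr ⟨i, 0, hk, hk', Or.inl ⟨rfl, rfl⟩⟩
      · have e := hlen i
        rw [((H.c i ho).cl hk (by omega)).1, ((H'.c i ho).cl hk' (by omega)).1, hγ, hγ]
        refine Or.inr ⟨i, (P i).length - 1, by omega, by omega, Or.inr ⟨rfl, ?_⟩⟩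
        simp only [e]
    | succ k =>
      rw [(H.chain i k hk).1, (H'.chain i k hk').1, hγ, hγ]
      exact Or.inr ⟨i, k, by omega, by omega, Or.inr ⟨rfl, rfl⟩⟩
  · by_cases hk1 : k + 1 < (P i).length
    · have hk1' : k + 1 < (P' i).length := by rw [← hlen i]; exact hk1
      rw [← (H.chain i k hk1).1, ← (H'.chain i k hk1').1]
      exact Or.inr ⟨i, k + 1, hk1, hk1', Or.inl ⟨rfl, rfl⟩⟩
    · have e := hlen i
      by_cases ho : op i
      · have e1 : k = (P i).length - 1 := by omega
        have e2 : k = (P' i).length - 1 := by omega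
        have a1 := (H.o i ho).lst (by omega)
        have a2 := (H'.o i ho).lst (by omega)
        simp only [← e1] at a1
        simp only [← e2] at a2
        rw [a1, a2]
        exact Or.inr ⟨i, k, hk, hk', Or.inr ⟨rfl, rfl⟩⟩
      · have e1 : k = (P i).length - 1 := by omega
        have e2 : k = (P' i).length - 1 := by omega
        have a1 := ((H.c i ho).cl (by omega) (by omega)).1
        have a2 := ((H'.c i ho).cl (by omega) (by omega)).1
        simp only [← e1] at a1
        simp only [← e2] at a2
        rw [← a1, ← a2]
        exact Or.inr ⟨i, 0, by omega, by omega, Or.inl ⟨rfl, rfl⟩⟩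

theorem R.symm (hA : ∀ c, γ c = c → γ (M c) = M c → M' c = M c)
    {c d : C} (h : R M M' γ P P' c d) : R M' M γ P' P d c := by
  rcases h with ⟨h1, h2, rfl⟩ | ⟨i, k, hk, hk', h⟩
  · exact Or.inl ⟨h1, by rw [hA _ h1 h2, h2], rfl⟩
  · exact Or.inr ⟨i, k, hk', hk, by tauto⟩

theorem exists_sigma [Finite C] (hM : ∀ c, M (M c) = c) (hMne : ∀ c, M c ≠ c)
    (hM' : ∀ c, M' (M' c) = c) (hMne' : ∀ c, M' c ≠ c)
    (hγ : ∀ c, γ (γ c) = c)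
    (hA : ∀ c, γ c = c → γ (M c) = M c → M' c = M c)
    (H : Side M γ P op) (H' : Side M' γ P' op)
    (hlen : ∀ i, (P i).length = (P' i).length) :
    ∃ σ : Equiv.Perm C, (∀ c, σ (M c) = M' (σ c)) ∧ (∀ c, σ (γ c) = γ (σ c)) ∧
      ∀ c, R M M' γ P P' c (σ c) := by
  choose s hs using fun c => R.total (M' := M') hM H hlen c
  have inj : Function.Injective s := by
    intro a b hab
    have h1 := (hs a).symm hA
    have h2 := (hs b).symm hA
    rw [hab] at h1
    exact R.func hM' hMne' hγ H' h1 h2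
  refine ⟨Equiv.ofBijective s (Finite.injective_iff_bijective.1 inj), ?_, ?_, hs⟩
  · intro c
    exact R.func hM hMne hγ H (hs (M c)) ((hs c).mate hM hM' hA)
  · intro c
    exact R.func hM hMne hγ H (hs (γ c)) ((hs c).glue hγ H H' hlen)

end BW

namespace BW

theorem sign_sigma_single {ι : Type} [Fintype ι] [DecidableEq ι] {n : ι → ℕ} (a : ι)
    (x : Equiv.Perm (Fin (n a))) :
    Equiv.Perm.sign (Equiv.Perm.sigmaCongrRightHom (fun i => Fin (n i)) (Pi.mulSingle a x)) =
      Equiv.Perm.sign x := by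
  symm
  have h0 : ∀ y, Equiv.Perm.sigmaCongrRightHom (fun i => Fin (n i)) (Pi.mulSingle a x) ⟨a, y⟩ =
      ⟨a, x y⟩ := by
    intro y
    change (⟨a, (Pi.mulSingle a x : ∀ i, Equiv.Perm (Fin (n i))) a y⟩ : TabCell n) = _
    rw [Pi.mulSingle_eq_same]
  refine Equiv.Perm.sign_bij (fun y _ => (⟨a, y⟩ : TabCell n)) ?_ ?_ ?_
  · intro y _ _
    exact (h0 y).symm
  · intro y z _ _ h
    simpa using h
  · rintro ⟨i, y⟩ h
    by_cases hi : i = a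
    · subst hi
      refine ⟨y, ?_, rfl⟩
      intro h2
      apply h
      rw [h0, h2]
    · exfalso
      apply h
      change (⟨i, (Pi.mulSingle a x : ∀ i, Equiv.Perm (Fin (n i))) i y⟩ : TabCell n) = _
      rw [Pi.mulSingle_eq_of_ne hi]
      rfl

theorem sign_sigma {ι : Type} [Fintype ι] [DecidableEq ι] {n : ι → ℕ}
    (σ : ∀ i, Equiv.Perm (Fin (n i))) :
    Equiv.Perm.sign (Equiv.sigmaCongrRight σ : Equiv.Perm (TabCell n)) =
      ∏ i, Equiv.Perm.sign (σ i) := by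
  have key : ∀ (S : Finset ι) (σ : ∀ i, Equiv.Perm (Fin (n i))), (∀ i, i ∉ S → σ i = 1) →
      Equiv.Perm.sign (Equiv.Perm.sigmaCongrRightHom (fun i => Fin (n i)) σ) =
        ∏ i ∈ S, Equiv.Perm.sign (σ i) := by
    intro S
    induction S using Finset.induction_on with
    | empty =>
      intro σ h
      have : σ = 1 := funext fun i => h i (by simp)
      subst this
      simp
    | insert a S ha ih =>
      intro σ h
      have e : σ = Pi.mulSingle a (σ a) * Function.update σ a 1 := by
        funext i
        by_cases hi : i = a
        · subst hi; simp
        · simp [hi]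
      conv_lhs => rw [e, map_mul, Equiv.Perm.sign_mul, sign_sigma_single]
      rw [Finset.prod_insert ha, ih]
      · congr 1
        apply Finset.prod_congr rfl
        intro i hi
        have : i ≠ a := fun h => ha (h ▸ hi)
        simp [this]
      · intro i hi
        by_cases hia : i = a
        · subst hia; simp
        · simp only [Function.update_of_ne hia]
          exact h i (by simp [hia, hi])
  exact key Finset.univ σ (by simp)

theorem sign_conj_mate {C : Type} [Fintype C] [DecidableEq C] (M σ : Equiv.Perm C)
    (t : C → Bool) (hM : ∀ c, M (M c) = c) (htM : ∀ c, t (M c) = !t c)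
    (hσ : ∀ c, t (σ c) = t c) (hσM : ∀ c, σ (M c) = M (σ c)) : Equiv.Perm.sign σ = 1 := by
  let σ1 : Equiv.Perm {c // t c = true} := σ.subtypePerm (fun c => by rw [hσ])
  let σ2 : Equiv.Perm {c // ¬ t c = true} := σ.subtypePerm (fun c => by rw [hσ])
  have h1 : σ = σ1.subtypeCongr σ2 := by
    ext c
    by_cases h : t c = true
    · exact (Equiv.Perm.subtypeCongr.left_apply (p := fun c => t c = true) σ1 σ2 h).symm
    · exact (Equiv.Perm.subtypeCongr.right_apply (p := fun c => t c = true) σ1 σ2 h).symm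
  have h2 : Equiv.Perm.sign σ1 = Equiv.Perm.sign σ2 := by
    refine Equiv.Perm.sign_eq_sign_of_equiv _ _
      (M.subtypeEquiv (fun c => by rw [htM]; cases t c <;> simp)) ?_
    rintro ⟨c, hc⟩
    apply Subtype.ext
    exact (hσM c).symm
  rw [h1, Equiv.Perm.sign_subtypeCongr, h2, Int.units_mul_self]

end BW

namespace TabSub
open BW
variable {A : Type} [CommRing A] {ι : Type} [Fintype ι] [DecidableEq ι] {n : ι → ℕ} {s : ℕ}

theorem matOf_mate (T : TabSub A ι n s) (c : TabCell n) (i j : ℕ) :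
    T.matOf (T.mate c) i j = T.matOf c j i := by
  unfold matOf
  rw [T.isTail_mate, T.lab_mate]
  cases T.isTail c <;> simp

theorem letter_mate (T : TabSub A ι n s) (c : TabCell n) :
    T.letter (T.mate c) = ((T.letter c).1, !(T.letter c).2) := by
  simp [letter, T.isTail_mate, T.lab_mate]

/-- The factor of an arrow, in either orientation. -/
def val (T : TabSub A ι n s) (π : ∀ i : ι, Equiv.Perm (Fin (n i))) (c : TabCell n) : A :=
  T.matOf c (π c.1 c.2 : Fin (n c.1)).1
    ((π (T.mate c).1 (T.mate c).2 : Fin (n (T.mate c).1)).1)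

theorem val_mate (T : TabSub A ι n s) (π : ∀ i : ι, Equiv.Perm (Fin (n i))) (c : TabCell n) :
    T.val π (T.mate c) = T.val π c := by
  unfold val
  rw [T.matOf_mate, T.mate_invol]

theorem entry_eq_val (T : TabSub A ι n s) (π : ∀ i : ι, Equiv.Perm (Fin (n i)))
    (c : TabCell n) (hc : T.isTail c = true) : T.entry π c = T.val π c := by
  unfold val entry matOf
  simp [hc]

theorem bpf0_relabel {t1 t2 : ℕ} (D1 : TabSub A ι n t1) (D2 : TabSub A ι n t2)
    (σ : ∀ i, Equiv.Perm (Fin (n i)))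
    (hm : ∀ c, D2.mate (Equiv.sigmaCongrRight σ c) = Equiv.sigmaCongrRight σ (D1.mate c))
    (hmat : ∀ c i j, i < n c.1 → j < n (D1.mate c).1 →
      D2.matOf (Equiv.sigmaCongrRight σ c) i j = D1.matOf c i j) :
    D2.bpf0 = sgnT σ • D1.bpf0 := by
  unfold bpf0
  rw [Finset.smul_sum]
  rw [← Equiv.sum_comp (Equiv.mulRight (σ⁻¹))]
  apply Finset.sum_congr rfl
  intro π _
  rw [Equiv.coe_mulRight, smul_smul]
  congr 1
  · unfold sgnT
    rw [← Finset.prod_mul_distrib]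
    apply Finset.prod_congr rfl
    intro i _
    simp [Equiv.Perm.sign_mul, Equiv.Perm.sign_inv, mul_comm]
  · have hval : ∀ c, D2.val (π * σ⁻¹) (Equiv.sigmaCongrRight σ c) = D1.val π c := by
      intro c
      unfold val
      rw [hm]
      have e : ∀ c : TabCell n, ((π * σ⁻¹) (Equiv.sigmaCongrRight σ c).1
          (Equiv.sigmaCongrRight σ c).2 : Fin _).1 = (π c.1 c.2 : Fin (n c.1)).1 := by
        rintro ⟨i, a⟩
        change ((π i) ((σ i)⁻¹ ((σ i) a)) : Fin _).1 = _
        simp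
      rw [e, e]
      exact hmat c _ _ (Fin.is_lt _) (Fin.is_lt _)
    symm
    set S : Equiv.Perm (TabCell n) := Equiv.sigmaCongrRight σ with hS
    have hm' : ∀ c, D1.mate (S.symm c) = S.symm (D2.mate c) := by
      intro c
      rw [Equiv.eq_symm_apply, ← hm, Equiv.apply_symm_apply]
    refine Finset.prod_bij' (fun c _ => if D2.isTail (S c) = true then S c else D2.mate (S c))
      (fun d _ => if D1.isTail (S.symm d) = true then S.symm d else D1.mate (S.symm d))
      ?_ ?_ ?_ ?_ ?_
    · intro c hc
      simp only [tails, Finset.mem_filter, Finset.mem_univ, true_and] at hc ⊢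
      split_ifs with h
      · exact h
      · rw [D2.isTail_mate]; simpa using h
    · intro c hc
      simp only [tails, Finset.mem_filter, Finset.mem_univ, true_and] at hc ⊢
      split_ifs with h
      · exact h
      · rw [D1.isTail_mate]; simpa using h
    · intro c hc
      simp only [tails, Finset.mem_filter, Finset.mem_univ, true_and] at hc
      by_cases h : D2.isTail (S c) = true
      · simp [h, hc]
      · simp [h, ← hm', hc, D1.isTail_mate, D1.mate_invol]
    · intro c hc
      simp only [tails, Finset.mem_filter, Finset.mem_univ, true_and] at hc
      by_cases h : D1.isTail (S.symm c) = true
      · simp [h, hc]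
      · simp [h, ← hm, hc, D2.isTail_mate, D2.mate_invol]
    · intro c hc
      simp only [tails, Finset.mem_filter, Finset.mem_univ, true_and] at hc
      rw [D1.entry_eq_val _ _ hc, ← hval]
      split_ifs with h
      · rw [D2.entry_eq_val _ _ h]
      · rw [D2.entry_eq_val, D2.val_mate]
        rw [D2.isTail_mate]; simpa using h

/-- Matrix of a letter. -/
def lm (T : TabSub A ι n s) (p : Fin s × Bool) : Matrix (Fin (dimBound n)) (Fin (dimBound n)) A :=
  Matrix.of fun i j => if p.2 then castEntry (T.X p.1) j i else castEntry (T.X p.1) i j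

theorem matListProd_eq (B : ℕ) (L : List (ℕ → ℕ → A)) (i j : Fin B) :
    matListProd B L i j =
      (L.map fun f => (Matrix.of fun a b : Fin B => f a b : Matrix (Fin B) (Fin B) A)).prod i j := by
  induction L generalizing i with
  | nil => simp [matListProd, Matrix.one_apply, Fin.ext_iff]
  | cons f fs ih =>
    simp only [matListProd, List.map_cons, List.prod_cons, Matrix.mul_apply, Matrix.of_apply]
    rw [Finset.sum_range]
    simp only [ih]

theorem wordMat_eq (T : TabSub A ι n s) (w : List (Fin s × Bool)) (i j : Fin (dimBound n)) :
    T.wordMat w i j = (w.map T.lm).prod i j := by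
  unfold wordMat
  rw [matListProd_eq, List.map_map]
  rfl

theorem pathMat_eq_wordMat (T : TabSub A ι n s) (l : List (TabCell n)) :
    T.pathMat l = T.wordMat (T.word l) := by
  unfold pathMat wordMat word
  rw [List.map_map]
  congr 1
  apply List.map_congr_left
  intro c _
  funext i j
  simp only [matOf, letter, Function.comp_apply]
  by_cases h : T.isTail c = true <;> simp [h]

theorem lm_flip (T : TabSub A ι n s) (p : Fin s × Bool) :
    T.lm (p.1, !p.2) = (T.lm p).transpose := by
  ext i j
  obtain ⟨a, b⟩ := p
  cases b <;> simp [lm]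

theorem lm_wtp (T : TabSub A ι n s) (w : List (Fin s × Bool)) :
    ((wtp w).map T.lm).prod = (w.map T.lm).prod.transpose := by
  rw [Matrix.transpose_list_prod, wtp, List.map_reverse, List.map_map, List.map_map]
  congr 2
  apply List.map_congr_left
  intro p _
  exact T.lm_flip p

theorem pathTr_eq (T : TabSub A ι n s) (l : List (TabCell n)) :
    T.pathTr l = ((T.word l).map T.lm).prod.trace := by
  unfold pathTr
  rw [Finset.sum_range, pathMat_eq_wordMat]
  simp only [wordMat_eq, Matrix.trace, Matrix.diag]

theorem trace_weqCT (T : TabSub A ι n s) {w w' : List (Fin s × Bool)} (h : weqCT w w') :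
    (w.map T.lm).prod.trace = (w'.map T.lm).prod.trace := by
  have rot : ∀ {u v : List (Fin s × Bool)}, u.IsRotated v →
      (u.map T.lm).prod.trace = (v.map T.lm).prod.trace := by
    rintro u v ⟨k, rfl⟩
    rw [List.rotate_eq_drop_append_take_mod]
    conv_lhs => rw [← List.take_append_drop (k % u.length) u]
    rw [List.map_append, List.map_append, List.prod_append, List.prod_append,
      Matrix.trace_mul_comm]
  rcases h with h | h
  · exact rot h
  · rw [rot h, T.lm_wtp, Matrix.trace_transpose]

end TabSub

namespace BW

theorem rel_pairs {α β : Type} {r : α → β → Prop} {s : Multiset α} {t : Multiset β}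
    (h : Multiset.Rel r s t) : ∃ P : Multiset (α × β), P.map Prod.fst = s ∧
      P.map Prod.snd = t ∧ ∀ p ∈ P, r p.1 p.2 := by
  induction h with
  | zero => exact ⟨0, by simp⟩
  | cons hab _ ih =>
    obtain ⟨P, h1, h2, h3⟩ := ih
    refine ⟨(_, _) ::ₘ P, by rw [Multiset.map_cons, h1], by rw [Multiset.map_cons, h2], ?_⟩
    intro p hp
    rcases Multiset.mem_cons.1 hp with rfl | hp
    · exact hab
    · exact h3 p hp

variable {C : Type} {M γ : C → C}

theorem Cls.rot {l l' : List C} (h : Cls M γ l) (hr : l.IsRotated l') : Cls M γ l' := by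
  obtain ⟨k, rfl⟩ := hr
  have hp := h.pos
  have hm : ∀ i (hi : i < l.length), l[(i+1) % l.length]'(Nat.mod_lt _ hp) = γ (M l[i]) := by
    intro i hi
    by_cases h1 : i + 1 < l.length
    · simp only [Nat.mod_eq_of_lt h1]
      exact (h.chain i h1).1
    · have e : i + 1 = l.length := by omega
      simp only [e, Nat.mod_self]
      have e2 : i = l.length - 1 := by omega
      subst e2
      exact (h.cl hp (by omega)).1
  have hne : ∀ x ∈ l.rotate k, γ x ≠ x := by
    intro x hx
    exact h.ne (List.mem_rotate.1 hx)
  refine ⟨?_, List.nodup_rotate.2 h.nodup, by simpa using hp, ?_⟩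
  · intro i hi
    refine ⟨?_, hne _ (List.getElem_mem _)⟩
    rw [List.getElem_rotate, List.getElem_rotate, ← hm _ (Nat.mod_lt _ hp)]
    apply gidx
    rw [Nat.mod_add_mod]
    congr 1; omega
  · intro h0 h1
    refine ⟨?_, hne _ (List.getElem_mem _)⟩
    rw [List.getElem_rotate, List.getElem_rotate, ← hm _ (Nat.mod_lt _ hp)]
    apply gidx
    rw [Nat.mod_add_mod, List.length_rotate,
      show l.length - 1 + k + 1 = 0 + k + l.length by omega, Nat.add_mod_right]

theorem mkSide [Finite C] {Ro Rc : Set (List C)} (H : Reps M γ Ro Rc)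
    (hM : ∀ c, M (M c) = c) (hγ : ∀ c, γ (γ c) = c) {I : Type} (Q P : I → List C)
    (op : I → Prop) (ho : ∀ i, op i → Q i ∈ Ro) (hc : ∀ i, ¬ op i → Q i ∈ Rc)
    (hinj : ∀ i j, (op i ↔ op j) → Q i = Q j → i = j)
    (hsurj : ∀ l, (l ∈ Ro ∨ l ∈ Rc) → ∃ i, Q i = l)
    (hPo : ∀ i, op i → P i = Q i ∨ P i = rv M (Q i))
    (hPc : ∀ i, ¬ op i → (P i).IsRotated (Q i) ∨ (P i).IsRotated (rv M (Q i))) :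
    Side M γ P op := by
  have hT : ∀ x i, Tch M x (P i) ↔ Tch M x (Q i) := by
    intro x i
    by_cases h : op i
    · rcases hPo i h with h | h <;> rw [h]
      exact Tch.rv hM
    · rcases hPc i h with h | h
      · exact Tch.rot h
      · exact (Tch.rot h).trans (Tch.rv hM)
  refine ⟨?_, ?_, ?_, ?_⟩
  · intro i h
    have := H.o1 _ (ho i h)
    rcases hPo i h with h | h <;> rw [h]
    · exact this
    · exact this.rv hM hγ
  · intro i h
    have := H.c1 _ (hc i h)
    rcases hPc i h with h | h
    · exact this.rot h.symm
    · exact (this.rv hM hγ).rot h.symm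
  · intro x hx
    obtain ⟨l, hl, ht⟩ := H.cover hM hγ x hx
    obtain ⟨i, rfl⟩ := hsurj l hl
    exact ⟨i, (hT _ _).2 ht⟩
  · intro x i j hi hj
    have hmem : ∀ i, Q i ∈ Ro ∨ Q i ∈ Rc := fun i => by
      by_cases h : op i
      · exact Or.inl (ho i h)
      · exact Or.inr (hc i h)
    have e := H.sep hM hγ x (hmem i) (hmem j) ((hT _ _).1 hi) ((hT _ _).1 hj)
    have oc : ∀ i j, op i → ¬ op j → Q i = Q j → False := by
      intro i j hi hj e
      have a1 := H.o1 _ (ho i hi)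
      have a2 := H.c1 _ (hc j hj)
      rw [← e] at a2
      exact opn_cls hM hγ a1 a2 (List.getElem_mem a2.pos) (List.getElem_mem a2.pos)
    refine hinj i j ?_ e
    constructor
    · intro h; by_contra h'; exact oc i j h h' e
    · intro h; by_contra h'; exact oc j i h h' e.symm

/-- Existence of matched systems. -/
theorem exists_sides [Finite C] {M' : C → C} {Λ : Type} (L L' : C → Λ) (fl : Λ → Λ)
    (hL' : ∀ c, L' (M' c) = fl (L' c))
    (hM : ∀ c, M (M c) = c) (hM' : ∀ c, M' (M' c) = c) (hγ : ∀ c, γ (γ c) = c)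
    {Ro Rc Ro' Rc' : Finset (List C)}
    (H : Reps M γ (Ro : Set (List C)) (Rc : Set (List C)))
    (H' : Reps M' γ (Ro' : Set (List C)) (Rc' : Set (List C)))
    (ho : Multiset.Rel (fun w w' => w = w' ∨ w = (w'.map fl).reverse)
      (Ro.val.map (List.map L)) (Ro'.val.map (List.map L')))
    (hc : Multiset.Rel (fun w w' => w.IsRotated w' ∨ w.IsRotated (w'.map fl).reverse)
      (Rc.val.map (List.map L)) (Rc'.val.map (List.map L'))) :
    ∃ (I : Type) (P P' : I → List C) (op : I → Prop), Side M γ P op ∧ Side M' γ P' op ∧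
      ∀ i, (P i).map L = (P' i).map L' := by
  have hw : ∀ l : List C, ((l.map L').map fl).reverse = (rv M' l).map L' := by
    intro l
    simp [rv, List.map_reverse, hL', Function.comp_def]
  rw [Multiset.rel_map] at ho hc
  obtain ⟨A, A1, A2, A3⟩ := rel_pairs ho
  obtain ⟨B, B1, B2, B3⟩ := rel_pairs hc
  have hA : ∀ p : {p // p ∈ A}, ∃ l, (l = p.1.2 ∨ l = rv M' p.1.2) ∧
      p.1.1.map L = l.map L' := by
    rintro ⟨p, hp⟩
    rcases A3 p hp with h | h
    · exact ⟨_, Or.inl rfl, h⟩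
    · exact ⟨_, Or.inr rfl, by rw [h, hw]⟩
  have hB : ∀ p : {p // p ∈ B}, ∃ l : List C, (l.IsRotated p.1.2 ∨ l.IsRotated (rv M' p.1.2)) ∧
      p.1.1.map L = l.map L' := by
    rintro ⟨p, hp⟩
    rcases B3 p hp with h | h
    · obtain ⟨k, hk⟩ := h.symm
      exact ⟨p.2.rotate k, Or.inl (List.IsRotated.symm ⟨k, rfl⟩),
        by rw [← hk, List.map_rotate]⟩
    · rw [hw] at h
      obtain ⟨k, hk⟩ := h.symm
      exact ⟨(rv M' p.2).rotate k, Or.inr (List.IsRotated.symm ⟨k, rfl⟩),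
        by rw [← hk, List.map_rotate]⟩
  choose FA FA1 FA2 using hA
  choose FB FB1 FB2 using hB
  have nA1 : (A.map Prod.fst).Nodup := by rw [A1]; exact Ro.nodup
  have nA2 : (A.map Prod.snd).Nodup := by rw [A2]; exact Ro'.nodup
  have nB1 : (B.map Prod.fst).Nodup := by rw [B1]; exact Rc.nodup
  have nB2 : (B.map Prod.snd).Nodup := by rw [B2]; exact Rc'.nodup
  refine ⟨{p // p ∈ A} ⊕ {p // p ∈ B}, Sum.elim (fun p => p.1.1) (fun p => p.1.1),
    Sum.elim FA FB, fun i => i.isLeft = true, ?_, ?_, ?_⟩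
  · refine mkSide H hM hγ (Sum.elim (fun p => p.1.1) (fun p => p.1.1)) _ _ ?_ ?_ ?_ ?_ ?_ ?_
    · rintro (⟨p, hp⟩ | ⟨p, hp⟩) h
      · have := Multiset.mem_map_of_mem Prod.fst hp
        rw [A1] at this
        exact this
      · simp at h
    · rintro (⟨p, hp⟩ | ⟨p, hp⟩) h
      · simp at h
      · have := Multiset.mem_map_of_mem Prod.fst hp
        rw [B1] at this
        exact this
    · rintro (⟨p, hp⟩ | ⟨p, hp⟩) (⟨p', hp'⟩ | ⟨p', hp'⟩) h1 h2
      · have := Multiset.inj_on_of_nodup_map nA1 p hp p' hp' h2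
        subst this; rfl
      · simp at h1
      · simp at h1
      · have := Multiset.inj_on_of_nodup_map nB1 p hp p' hp' h2
        subst this; rfl
    · rintro l (hl | hl)
      · have hl : l ∈ Ro.val := hl
        rw [← A1, Multiset.mem_map] at hl
        obtain ⟨p, hp, rfl⟩ := hl
        exact ⟨Sum.inl ⟨p, hp⟩, rfl⟩
      · have hl : l ∈ Rc.val := hl
        rw [← B1, Multiset.mem_map] at hl
        obtain ⟨p, hp, rfl⟩ := hl
        exact ⟨Sum.inr ⟨p, hp⟩, rfl⟩
    · intro i _; exact Or.inl rfl
    · intro i _; exact Or.inl (List.IsRotated.refl _)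
  · refine mkSide H' hM' hγ (Sum.elim (fun p => p.1.2) (fun p => p.1.2)) _ _ ?_ ?_ ?_ ?_ ?_ ?_
    · rintro (⟨p, hp⟩ | ⟨p, hp⟩) h
      · have := Multiset.mem_map_of_mem Prod.snd hp
        rw [A2] at this
        exact this
      · simp at h
    · rintro (⟨p, hp⟩ | ⟨p, hp⟩) h
      · simp at h
      · have := Multiset.mem_map_of_mem Prod.snd hp
        rw [B2] at this
        exact this
    · rintro (⟨p, hp⟩ | ⟨p, hp⟩) (⟨p', hp'⟩ | ⟨p', hp'⟩) h1 h2
      · have := Multiset.inj_on_of_nodup_map nA2 p hp p' hp' h2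
        subst this; rfl
      · simp at h1
      · simp at h1
      · have := Multiset.inj_on_of_nodup_map nB2 p hp p' hp' h2
        subst this; rfl
    · rintro l (hl | hl)
      · have hl : l ∈ Ro'.val := hl
        rw [← A2, Multiset.mem_map] at hl
        obtain ⟨p, hp, rfl⟩ := hl
        exact ⟨Sum.inl ⟨p, hp⟩, rfl⟩
      · have hl : l ∈ Rc'.val := hl
        rw [← B2, Multiset.mem_map] at hl
        obtain ⟨p, hp, rfl⟩ := hl
        exact ⟨Sum.inr ⟨p, hp⟩, rfl⟩
    · rintro (i | i) h
      · exact FA1 i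
      · simp at h
    · rintro (i | i) h
      · simp at h
      · exact FB1 i
  · rintro (i | i)
    · exact FA2 i
    · exact FB2 i

end BW

namespace TabSub
open BW
variable {A : Type} [CommRing A] {ι : Type} [Fintype ι] [DecidableEq ι] {n : ι → ℕ} {s : ℕ}

/-- Identification of the cells of the two distinguished columns. -/
def glue (q1 q2 : ι) (hn : n q1 = n q2) (c : TabCell n) : TabCell n :=
  if h : c.1 = q1 then ⟨q2, Fin.cast (by rw [h, hn]) c.2⟩
  else if h : c.1 = q2 then ⟨q1, Fin.cast (by rw [h, hn]) c.2⟩ else c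

theorem glue_q1 (q1 q2 : ι) (hn : n q1 = n q2) (a : Fin (n q1)) :
    glue q1 q2 hn ⟨q1, a⟩ = ⟨q2, Fin.cast hn a⟩ := by simp [glue]

theorem glue_q2 {q1 q2 : ι} (hq : q1 ≠ q2) (hn : n q1 = n q2) (a : Fin (n q2)) :
    glue q1 q2 hn ⟨q2, a⟩ = ⟨q1, Fin.cast hn.symm a⟩ := by simp [glue, hq.symm]

theorem glue_other {q1 q2 : ι} (hn : n q1 = n q2) (c : TabCell n) (h : c.1 ≠ q1 ∧ c.1 ≠ q2) :
    glue q1 q2 hn c = c := by simp [glue, h.1, h.2]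

theorem glue_glue {q1 q2 : ι} (hq : q1 ≠ q2) (hn : n q1 = n q2) (c : TabCell n) :
    glue q1 q2 hn (glue q1 q2 hn c) = c := by
  obtain ⟨i, a⟩ := c
  by_cases h1 : i = q1
  · subst h1; rw [glue_q1, glue_q2 hq]; rfl
  · by_cases h2 : i = q2
    · subst h2; rw [glue_q2 hq, glue_q1]; rfl
    · rw [glue_other hn ⟨i, a⟩ ⟨h1, h2⟩, glue_other hn ⟨i, a⟩ ⟨h1, h2⟩]

theorem glue_fixed {q1 q2 : ι} (hq : q1 ≠ q2) (hn : n q1 = n q2) (c : TabCell n) :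
    glue q1 q2 hn c = c ↔ (c.1 ≠ q1 ∧ c.1 ≠ q2) := by
  constructor
  · obtain ⟨i, a⟩ := c
    intro h
    constructor
    · rintro rfl
      rw [glue_q1] at h
      exact hq (congrArg Sigma.fst h).symm
    · rintro rfl
      rw [glue_q2 hq] at h
      exact hq (congrArg Sigma.fst h)
  · exact glue_other hn c

theorem glue_succ {q1 q2 : ι} (hq : q1 ≠ q2) (hn : n q1 = n q2) (c d : TabCell n) :
    ((c.1 = q1 ∨ c.1 = q2) ∧ (d.1 = q1 ∨ d.1 = q2) ∧ c.1 ≠ d.1 ∧ (c.2 : ℕ) = (d.2 : ℕ)) ↔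
      (d = glue q1 q2 hn c ∧ glue q1 q2 hn d ≠ d) := by
  obtain ⟨i, a⟩ := c
  obtain ⟨j, b⟩ := d
  rw [show (glue q1 q2 hn ⟨j, b⟩ ≠ ⟨j, b⟩) ↔ _ from not_congr (glue_fixed hq hn ⟨j, b⟩)]
  constructor
  · rintro ⟨h1, h2, h3, h4⟩
    dsimp only at h1 h2 h3 h4
    refine ⟨?_, by dsimp only; tauto⟩
    rcases h1 with rfl | rfl <;> rcases h2 with rfl | rfl
    · exact absurd rfl h3
    · rw [glue_q1]; congr 1; exact Fin.ext h4.symm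
    · rw [glue_q2 hq]; congr 1; exact Fin.ext h4.symm
    · exact absurd rfl h3
  · rintro ⟨h1, h2⟩
    dsimp only at h2
    have h2' : j = q1 ∨ j = q2 := by tauto
    have h3 : (⟨i, a⟩ : TabCell n) = glue q1 q2 hn ⟨j, b⟩ := by rw [h1, glue_glue hq]
    rcases h2' with rfl | rfl
    · rw [glue_q1] at h3
      cases h3
      exact ⟨Or.inr rfl, Or.inl rfl, hq.symm, rfl⟩
    · rw [glue_q2 hq] at h3
      cases h3
      exact ⟨Or.inl rfl, Or.inr rfl, hq, rfl⟩

theorem isOpen_iff (T : TabSub A ι n s) {q1 q2 : ι} (hq : q1 ≠ q2) (hn : n q1 = n q2)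
    (l : List (TabCell n)) : T.IsOpenPath q1 q2 l ↔ Opn T.mate (glue q1 q2 hn) l := by
  have hch : l.Chain' (T.Succ q1 q2) ↔ Chn T.mate (glue q1 q2 hn) l := by
    change l.IsChain (T.Succ q1 q2) ↔ _
    rw [List.isChain_iff_getElem]
    unfold Chn Succ
    simp only [glue_succ hq hn]
  unfold IsOpenPath IsPath
  rw [hch]
  constructor
  · rintro ⟨⟨h1, h2, h3⟩, h4, h5⟩
    have h6 := h5 h1
    rw [List.head_eq_getElem, List.getLast_eq_getElem, ← glue_fixed hq hn, ← glue_fixed hq hn] at h6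
    exact ⟨h2, h3, h4, fun _ => h6.1, fun _ => h6.2⟩
  · intro h
    have h2 := h.two
    refine ⟨⟨List.ne_nil_of_length_pos (by omega), h.chain, h.nodup⟩, h2, ?_⟩
    intro h0
    rw [List.head_eq_getElem, List.getLast_eq_getElem, ← glue_fixed hq hn, ← glue_fixed hq hn]
    exact ⟨h.hd _, h.lst _⟩

theorem isClosed_iff (T : TabSub A ι n s) {q1 q2 : ι} (hq : q1 ≠ q2) (hn : n q1 = n q2)
    (l : List (TabCell n)) : T.IsClosedPath q1 q2 l ↔ Cls T.mate (glue q1 q2 hn) l := by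
  have hch : l.Chain' (T.Succ q1 q2) ↔ Chn T.mate (glue q1 q2 hn) l := by
    change l.IsChain (T.Succ q1 q2) ↔ _
    rw [List.isChain_iff_getElem]
    unfold Chn Succ
    simp only [glue_succ hq hn]
  unfold IsClosedPath IsPath
  rw [hch]
  constructor
  · rintro ⟨⟨h1, h2, h3⟩, h5⟩
    have h6 := h5 h1
    unfold Succ at h6
    rw [List.head_eq_getElem, List.getLast_eq_getElem, glue_succ hq hn] at h6
    exact ⟨h2, h3, List.length_pos_of_ne_nil h1, fun _ _ => h6⟩
  · intro h
    refine ⟨⟨List.ne_nil_of_length_pos h.pos, h.chain, h.nodup⟩, ?_⟩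
    intro h0
    unfold Succ
    rw [List.head_eq_getElem, List.getLast_eq_getElem, glue_succ hq hn]
    exact h.cl _ _

theorem reps_of (T : TabSub A ι n s) {q1 q2 : ι} (hq : q1 ≠ q2) (hn : n q1 = n q2)
    {Ro Rc : Finset (List (TabCell n))} (ho : T.OpenReps q1 q2 Ro) (hc : T.ClosedReps q1 q2 Rc) :
    Reps T.mate (glue q1 q2 hn) (Ro : Set (List (TabCell n))) (Rc : Set (List (TabCell n))) := by
  unfold OpenReps at ho
  unfold ClosedReps at hc
  simp only [isOpen_iff T hq hn] at ho
  simp only [isClosed_iff T hq hn] at hc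
  exact ⟨ho.1, hc.1, ho.2, hc.2⟩

end TabSub

namespace TabSub
open BW
variable {A : Type} [CommRing A] {ι : Type} [Fintype ι] [DecidableEq ι] {n : ι → ℕ} {s : ℕ}

theorem colPerm_other (q : ι) (τ : Equiv.Perm (Fin (n q))) (c : TabCell n) (h : c.1 ≠ q) :
    colPerm n q τ c = c := by
  obtain ⟨i, a⟩ := c
  have h : i ≠ q := h
  simp [colPerm, h]

theorem colPerm_symm_other (q : ι) (τ : Equiv.Perm (Fin (n q))) (c : TabCell n) (h : c.1 ≠ q) :
    (colPerm n q τ).symm c = c := by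
  rw [Equiv.symm_apply_eq, colPerm_other q τ c h]

theorem sign_colPerm (q : ι) (τ : Equiv.Perm (Fin (n q))) :
    Equiv.Perm.sign (colPerm n q τ) = Equiv.Perm.sign τ := by
  unfold colPerm
  rw [sign_sigma, Finset.prod_eq_single q]
  · simp
  · intro i _ hi
    simp [hi]
  · simp

theorem tw_mate (T : TabSub A ι n s) (q : ι) (τ : Equiv.Perm (Fin (n q))) (c : TabCell n) :
    (T.tw q τ).mate c = colPerm n q τ (T.mate ((colPerm n q τ).symm c)) := rfl

theorem tw_mate_other (T : TabSub A ι n s) (q : ι) (τ : Equiv.Perm (Fin (n q))) (c : TabCell n)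
    (h : c.1 ≠ q) (h2 : ((T.tw q τ).mate c).1 ≠ q) : (T.tw q τ).mate c = T.mate c := by
  rw [tw_mate, colPerm_symm_other q τ c h] at h2 ⊢
  exact colPerm_other q τ _ h2

theorem tw_letter_other (T : TabSub A ι n s) (q : ι) (τ : Equiv.Perm (Fin (n q))) (c : TabCell n)
    (h : c.1 ≠ q) : (T.tw q τ).letter c = T.letter c := by
  change T.letter ((colPerm n q τ).symm c) = _
  rw [colPerm_symm_other q τ c h]

/-- Column of a letter. -/
def colOf (T : TabSub A ι n s) (p : Fin s × Bool) : ι :=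
  if p.2 then T.colHead p.1 else T.colTail p.1

theorem colOf_letter (T : TabSub A ι n s) (c : TabCell n) : T.colOf (T.letter c) = c.1 := by
  unfold colOf letter
  by_cases h : T.isTail c = true
  · simp [h, T.colTail_eq c h]
  · have h' : T.isTail (T.mate c) = true := by rw [T.isTail_mate]; simpa using h
    have := T.colHead_eq _ h'
    rw [T.lab_mate, T.mate_invol] at this
    simp [h, this]

theorem exists_relabel (T : TabSub A ι n s) {q1 q2 : ι} (hq : q1 ≠ q2) (hn : n q1 = n q2)
    (π τ : Equiv.Perm (Fin (n q2))) {Ro Rc Ro' Rc' : Finset (List (TabCell n))}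
    (h1 : (T.tw q2 π).OpenReps q1 q2 Ro) (h2 : (T.tw q2 π).ClosedReps q1 q2 Rc)
    (h1' : (T.tw q2 τ).OpenReps q1 q2 Ro') (h2' : (T.tw q2 τ).ClosedReps q1 q2 Rc')
    (ho : Multiset.Rel weqT ((T.tw q2 π).wordsOf Ro) ((T.tw q2 τ).wordsOf Ro'))
    (hc : Multiset.Rel weqCT ((T.tw q2 π).wordsOf Rc) ((T.tw q2 τ).wordsOf Rc')) :
    ∃ σ : Equiv.Perm (TabCell n), (∀ c, σ ((T.tw q2 π).mate c) = (T.tw q2 τ).mate (σ c)) ∧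
      (∀ c, σ (glue q1 q2 hn c) = glue q1 q2 hn (σ c)) ∧
      ∀ c, (T.tw q2 τ).letter (σ c) = (T.tw q2 π).letter c := by
  obtain ⟨I, P, P', op, S, S', hw⟩ := exists_sides (T.tw q2 π).letter (T.tw q2 τ).letter
    (fun p => (p.1, !p.2)) (T.tw q2 τ).letter_mate (T.tw q2 π).mate_invol
    (T.tw q2 τ).mate_invol (glue_glue hq hn) (reps_of _ hq hn h1 h2) (reps_of _ hq hn h1' h2')
    ho hc
  obtain ⟨σ, s1, s2, s3⟩ := exists_sigma (T.tw q2 π).mate_invol (T.tw q2 π).mate_ne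
    (T.tw q2 τ).mate_invol (T.tw q2 τ).mate_ne (glue_glue hq hn) (by
      intro c hc1 hc2
      rw [glue_fixed hq hn] at hc1 hc2
      have e := tw_mate_other T q2 π c hc1.2 hc2.2
      rw [e] at hc2 ⊢
      rw [tw_mate, colPerm_symm_other q2 τ c hc1.2, colPerm_other q2 τ _ hc2.2]) S S'
      (fun i => by simpa using congrArg List.length (hw i))
  refine ⟨σ, s1, s2, ?_⟩
  intro c
  have hk : ∀ i k (h : k < (P i).length) (h' : k < (P' i).length),
      (T.tw q2 τ).letter (P' i)[k] = (T.tw q2 π).letter (P i)[k] := by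
    intro i k h h'
    have e : ((P i).map (T.tw q2 π).letter)[k]? = ((P' i).map (T.tw q2 τ).letter)[k]? := by
      rw [hw i]
    simpa [h, h', eq_comm] using e
  rcases s3 c with ⟨g1, g2, g3⟩ | ⟨i, k, h, h', ⟨g1, g2⟩ | ⟨g1, g2⟩⟩
  · rw [g3]
    rw [glue_fixed hq hn] at g1
    rw [tw_letter_other _ _ _ _ g1.2, tw_letter_other _ _ _ _ g1.2]
  · rw [g2, hk i k h h', ← g1]
  · rw [g2, letter_mate, hk i k h h', ← letter_mate, ← g1]

theorem relabel_col (T : TabSub A ι n s) (q2 : ι) (π τ : Equiv.Perm (Fin (n q2)))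
    (σ : Equiv.Perm (TabCell n)) (hl : ∀ c, (T.tw q2 τ).letter (σ c) = (T.tw q2 π).letter c)
    (c : TabCell n) : (σ c).1 = c.1 := by
  rw [← (T.tw q2 τ).colOf_letter, hl]
  exact (T.tw q2 π).colOf_letter c

theorem exists_sigmaCongr (σ : Equiv.Perm (TabCell n)) (h : ∀ c, (σ c).1 = c.1) :
    ∃ f : ∀ i, Equiv.Perm (Fin (n i)), σ = Equiv.sigmaCongrRight f := by
  have hs : ∀ c, (σ.symm c).1 = c.1 := fun c => by
    conv_rhs => rw [← σ.apply_symm_apply c, h]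
  have key : ∀ (i : ι) (c : TabCell n), c.1 = i → ∃ b, c = ⟨i, b⟩ := by
    rintro i ⟨j, a⟩ rfl; exact ⟨a, rfl⟩
  choose F hF using fun (i : ι) (a : Fin (n i)) => key i (σ ⟨i, a⟩) (h ⟨i, a⟩)
  choose G hG using fun (i : ι) (a : Fin (n i)) => key i (σ.symm ⟨i, a⟩) (hs ⟨i, a⟩)
  refine ⟨fun i => ⟨F i, G i, ?_, ?_⟩, ?_⟩
  · intro a
    have : (⟨i, G i (F i a)⟩ : TabCell n) = ⟨i, a⟩ := by
      rw [← hG, ← hF, Equiv.symm_apply_apply]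
    exact eq_of_heq (Sigma.mk.inj_iff.1 this).2
  · intro a
    have : (⟨i, F i (G i a)⟩ : TabCell n) = ⟨i, a⟩ := by
      rw [← hF, ← hG, Equiv.apply_symm_apply]
    exact eq_of_heq (Sigma.mk.inj_iff.1 this).2
  · ext1 ⟨i, a⟩
    exact hF i a

theorem relabel_sign (T : TabSub A ι n s) (q2 : ι) (π τ : Equiv.Perm (Fin (n q2)))
    (σ : Equiv.Perm (TabCell n)) (hl : ∀ c, (T.tw q2 τ).letter (σ c) = (T.tw q2 π).letter c)
    (hm : ∀ c, σ ((T.tw q2 π).mate c) = (T.tw q2 τ).mate (σ c)) :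
    Equiv.Perm.sign σ = Equiv.Perm.sign π * Equiv.Perm.sign τ := by
  have h := sign_conj_mate T.mate ((colPerm n q2 τ)⁻¹ * σ * colPerm n q2 π) T.isTail
    T.mate_invol T.isTail_mate (by
      intro c
      have := congrArg Prod.snd (hl (colPerm n q2 π c))
      have h2 : (!T.isTail ((colPerm n q2 τ).symm (σ (colPerm n q2 π c)))) =
        (!T.isTail ((colPerm n q2 π).symm (colPerm n q2 π c))) := this
      rw [Equiv.symm_apply_apply] at h2
      exact Bool.not_inj h2) (by
      intro c
      have := hm (colPerm n q2 π c)
      rw [tw_mate, tw_mate, Equiv.symm_apply_apply] at this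
      change (colPerm n q2 τ).symm (σ (colPerm n q2 π (T.mate c))) = _
      rw [this, Equiv.symm_apply_apply]
      rfl)
  rw [Equiv.Perm.sign_mul, Equiv.Perm.sign_mul, Equiv.Perm.sign_inv] at h
  rw [sign_colPerm, sign_colPerm] at h
  have h1 := Int.units_mul_self (Equiv.Perm.sign π)
  have h2 := Int.units_mul_self (Equiv.Perm.sign τ)
  calc Equiv.Perm.sign σ = (Equiv.Perm.sign τ * Equiv.Perm.sign τ) * Equiv.Perm.sign σ *
        (Equiv.Perm.sign π * Equiv.Perm.sign π) := by rw [h1, h2, one_mul, mul_one]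
    _ = Equiv.Perm.sign π * Equiv.Perm.sign τ *
        (Equiv.Perm.sign τ * Equiv.Perm.sign σ * Equiv.Perm.sign π) := by ac_rfl
    _ = _ := by rw [h, mul_one]

theorem relabel_sgnT {q1 q2 : ι} (hq : q1 ≠ q2) (hn : n q1 = n q2)
    (f : ∀ i, Equiv.Perm (Fin (n i)))
    (hg : ∀ c, Equiv.sigmaCongrRight f (glue q1 q2 hn c) =
      glue q1 q2 hn (Equiv.sigmaCongrRight f c)) :
    sgnT (fun i : {i : ι // i ≠ q1 ∧ i ≠ q2} => f i.1) =
      ((Equiv.Perm.sign (Equiv.sigmaCongrRight f : Equiv.Perm (TabCell n)) : ℤˣ) : ℤ) := by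
  have e : Equiv.Perm.sign (f q1) = Equiv.Perm.sign (f q2) := by
    refine Equiv.Perm.sign_eq_sign_of_equiv _ _ (finCongr hn) ?_
    intro a
    have := hg ⟨q1, a⟩
    rw [glue_q1, Equiv.sigmaCongrRight_apply, Equiv.sigmaCongrRight_apply] at this
    change (⟨q2, f q2 (Fin.cast hn a)⟩ : TabCell n) = glue q1 q2 hn ⟨q1, f q1 a⟩ at this
    rw [glue_q1] at this
    exact (eq_of_heq (Sigma.mk.inj_iff.1 this).2).symm
  rw [sign_sigma]
  unfold sgnT
  rw [Units.coe_prod]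
  rw [← Fintype.prod_subtype_mul_prod_subtype (fun i : ι => i ≠ q1 ∧ i ≠ q2)
    (fun i => ((Equiv.Perm.sign (f i) : ℤˣ) : ℤ))]
  have h2 : ∏ i : {i : ι // ¬ (i ≠ q1 ∧ i ≠ q2)}, ((Equiv.Perm.sign (f i.1) : ℤˣ) : ℤ) = 1 := by
    rw [← Finset.prod_subtype ({q1, q2} : Finset ι) (fun x => by simp; tauto)
      (fun i => ((Equiv.Perm.sign (f i) : ℤˣ) : ℤ)), Finset.prod_pair hq, e]
    rw [← Units.val_mul, Int.units_mul_self]; rfl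
  rw [h2, mul_one]

theorem trClosed_eq (T : TabSub A ι n s) (q2 : ι) (π τ : Equiv.Perm (Fin (n q2)))
    (Rc Rc' : Finset (List (TabCell n)))
    (hc : Multiset.Rel weqCT ((T.tw q2 π).wordsOf Rc) ((T.tw q2 τ).wordsOf Rc')) :
    trClosed (T.tw q2 π) Rc = trClosed (T.tw q2 τ) Rc' := by
  have h : ∀ {u v : Multiset (List (Fin s × Bool))}, Multiset.Rel weqCT u v →
      (u.map fun w => (w.map T.lm).prod.trace).prod =
      (v.map fun w => (w.map T.lm).prod.trace).prod := by
    intro u v h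
    induction h with
    | zero => rfl
    | cons hab _ ih => simp only [Multiset.map_cons, Multiset.prod_cons, ih, T.trace_weqCT hab]
  have e : ∀ (ρ : Equiv.Perm (Fin (n q2))) (R : Finset (List (TabCell n))),
      trClosed (T.tw q2 ρ) R = ((((T.tw q2 ρ).wordsOf R)).map
        fun w => (w.map T.lm).prod.trace).prod := by
    intro ρ R
    unfold trClosed wordsOf Finset.prod
    rw [Multiset.map_map]
    congr 1
    apply Multiset.map_congr rfl
    intro l _
    exact (T.tw q2 ρ).pathTr_eq l
  rw [e, e, h hc]

end TabSub

namespace TabSub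
open BW
variable {A : Type} [CommRing A] {ι : Type} [Fintype ι] [DecidableEq ι] {n : ι → ℕ} {s : ℕ}

theorem embCell_inj {q1 q2 : ι} {c d : TabCell (fun i : {i : ι // i ≠ q1 ∧ i ≠ q2} => n i.1)}
    (h : embCell q1 q2 c = embCell q1 q2 d) : c = d := by
  obtain ⟨⟨i, hi⟩, a⟩ := c
  obtain ⟨⟨j, hj⟩, b⟩ := d
  unfold embCell at h
  cases h
  rfl

theorem word_tp (T : TabSub A ι n s) (l : List (TabCell n)) :
    T.word (T.tp l) = wtp (T.word l) := by
  simp [word, tp, wtp, letter_mate, Function.comp_def]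

theorem pathMat_tp (T : TabSub A ι n s) (l : List (TabCell n)) (i j : Fin (dimBound n)) :
    T.pathMat (T.tp l) i j = T.pathMat l j i := by
  rw [pathMat_eq_wordMat, pathMat_eq_wordMat, wordMat_eq, wordMat_eq, word_tp, lm_wtp]
  rfl

theorem tilde_path (T : TabSub A ι n s) {q1 q2 : ι} (hq : q1 ≠ q2) (hn : n q1 = n q2)
    {Ro : Finset (List (TabCell n))} (hRo : T.OpenReps q1 q2 Ro) {t : ℕ}
    (D : TabSub A {i : ι // i ≠ q1 ∧ i ≠ q2} (fun i => n i.1) t) (hD : IsTilde T q1 q2 Ro D)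
    (l : List (TabCell n)) (hl : Opn T.mate (glue q1 q2 hn) l)
    (c : TabCell (fun i : {i : ι // i ≠ q1 ∧ i ≠ q2} => n i.1))
    (h : l ≠ []) (hc : embCell q1 q2 c = l.head h) :
    embCell q1 q2 (D.mate c) = T.mate (l.getLast h) ∧
      ∀ i j : Fin (dimBound n), D.matOf c i j = T.pathMat l i j := by
  have key : ∀ l ∈ Ro, ∀ (h : l ≠ []), ∃ d, embCell q1 q2 d = l.head h ∧
      embCell q1 q2 (D.mate d) = T.mate (l.getLast h) ∧
      ∀ i j, D.matOf d i j = T.pathMat l i j := by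
    intro l hl h
    obtain ⟨_, h2, h3⟩ := hD.2.1 l hl h ((hRo.1 l hl).2.2 h).1
    exact ⟨_, rfl, h2, h3⟩
  obtain ⟨l', ⟨h1, h2⟩, -⟩ := hRo.2 l ((isOpen_iff T hq hn l).2 hl)
  rcases h2 with rfl | rfl
  · obtain ⟨d, d1, d2, d3⟩ := key l h1 h
    have : c = d := embCell_inj (hc.trans d1.symm)
    subst this
    exact ⟨d2, fun i j => d3 i j⟩
  · have h' : l' ≠ [] := (hRo.1 l' h1).1.1
    obtain ⟨d, d1, d2, d3⟩ := key l' h1 h'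
    have e1 : (T.tp l').head h = T.mate (l'.getLast h') := by
      simp [tp, List.head_reverse, List.getLast_map]
    have e2 : (T.tp l').getLast h = T.mate (l'.head h') := by
      simp [tp, List.getLast_reverse, List.head_map]
    have : c = D.mate d := embCell_inj (by rw [hc, d2, e1])
    subst this
    refine ⟨by rw [D.mate_invol, d1, e2, T.mate_invol], ?_⟩
    intro i j
    rw [matOf_mate, d3, pathMat_tp]

theorem le_dimBound (i : ι) : n i ≤ dimBound n :=
  Finset.single_le_sum (f := n) (fun _ _ => Nat.zero_le _) (Finset.mem_univ i)

theorem opn_map {C : Type} {M M' γ : C → C} (σ : Equiv.Perm C) (hm : ∀ c, σ (M c) = M' (σ c))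
    (hg : ∀ c, σ (γ c) = γ (σ c)) {l : List C} (h : Opn M γ l) : Opn M' γ (l.map σ) := by
  have hf : ∀ c, γ (σ c) = σ c ↔ γ c = c := fun c => by rw [← hg, σ.injective.eq_iff]
  refine ⟨?_, h.nodup.map σ.injective, by simpa using h.two, ?_, ?_⟩
  · intro i hi
    have hi' : i + 1 < l.length := by simpa using hi
    rw [List.getElem_map, List.getElem_map, ← hm, ← hg, Ne, hf, σ.injective.eq_iff]
    exact h.chain i hi'
  · intro h0
    rw [List.getElem_map, hf]
    exact h.hd _
  · intro h0
    rw [List.getElem_map, ← hm, hf]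
    have := h.two
    have e : (l.map σ).length - 1 = l.length - 1 := by simp
    simp only [e]
    exact h.lst (by omega)

theorem path_at {C : Type} [Finite C] {M γ : C → C} (hM : ∀ c, M (M c) = c)
    (hγ : ∀ c, γ (γ c) = c) (x : C) (hx : γ x = x) (hx2 : γ (M x) ≠ M x) :
    ∃ l, Opn M γ l ∧ ∃ h : l ≠ [], l.head h = x := by
  obtain ⟨l, hxl, hl | hl⟩ := exists_path hM hγ x (Or.inr hx2)
  · refine ⟨l, hl, List.ne_nil_of_mem hxl, ?_⟩
    obtain ⟨j, hj, rfl⟩ := List.getElem_of_mem hxl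
    cases j with
    | zero => rw [List.head_eq_getElem]
    | succ j => exact absurd hx (hl.chain j hj).2
  · exact absurd hx (hl.ne hxl)

theorem tilde_relabel (T : TabSub A ι n s) {q1 q2 : ι} (hq : q1 ≠ q2) (hn : n q1 = n q2)
    (π τ : Equiv.Perm (Fin (n q2))) {Ro Ro' : Finset (List (TabCell n))}
    (h1 : (T.tw q2 π).OpenReps q1 q2 Ro) (h1' : (T.tw q2 τ).OpenReps q1 q2 Ro') {t t' : ℕ}
    (D : TabSub A {i : ι // i ≠ q1 ∧ i ≠ q2} (fun i => n i.1) t)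
    (D' : TabSub A {i : ι // i ≠ q1 ∧ i ≠ q2} (fun i => n i.1) t')
    (hD : IsTilde (T.tw q2 π) q1 q2 Ro D) (hD' : IsTilde (T.tw q2 τ) q1 q2 Ro' D')
    (f : ∀ i, Equiv.Perm (Fin (n i)))
    (hm : ∀ c, Equiv.sigmaCongrRight f ((T.tw q2 π).mate c) =
      (T.tw q2 τ).mate (Equiv.sigmaCongrRight f c))
    (hg : ∀ c, Equiv.sigmaCongrRight f (glue q1 q2 hn c) =
      glue q1 q2 hn (Equiv.sigmaCongrRight f c))
    (hl : ∀ c, (T.tw q2 τ).letter (Equiv.sigmaCongrRight f c) = (T.tw q2 π).letter c) :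
    D'.bpf0 = sgnT (fun i : {i : ι // i ≠ q1 ∧ i ≠ q2} => f i.1) • D.bpf0 := by
  have hemb : ∀ c, embCell q1 q2 (Equiv.sigmaCongrRight
      (fun i : {i : ι // i ≠ q1 ∧ i ≠ q2} => f i.1) c) =
      Equiv.sigmaCongrRight f (embCell q1 q2 c) := fun c => rfl
  have key : ∀ c : TabCell (fun i : {i : ι // i ≠ q1 ∧ i ≠ q2} => n i.1),
      D'.mate (Equiv.sigmaCongrRight (fun i : {i : ι // i ≠ q1 ∧ i ≠ q2} => f i.1) c) =
        Equiv.sigmaCongrRight (fun i : {i : ι // i ≠ q1 ∧ i ≠ q2} => f i.1) (D.mate c) ∧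
      ∀ i j : Fin (dimBound n), D'.matOf (Equiv.sigmaCongrRight
        (fun i : {i : ι // i ≠ q1 ∧ i ≠ q2} => f i.1) c) i j = D.matOf c i j := by
    intro c
    by_cases hA : ((T.tw q2 π).mate (embCell q1 q2 c)).1 ≠ q1 ∧
        ((T.tw q2 π).mate (embCell q1 q2 c)).1 ≠ q2
    · obtain ⟨-, a2, a3⟩ := hD.1 c hA
      have hA' : ((T.tw q2 τ).mate (embCell q1 q2 (Equiv.sigmaCongrRight
          (fun i : {i : ι // i ≠ q1 ∧ i ≠ q2} => f i.1) c))).1 ≠ q1 ∧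
          ((T.tw q2 τ).mate (embCell q1 q2 (Equiv.sigmaCongrRight
          (fun i : {i : ι // i ≠ q1 ∧ i ≠ q2} => f i.1) c))).1 ≠ q2 := by
        rw [hemb, ← hm]; exact hA
      obtain ⟨-, b2, b3⟩ := hD'.1 _ hA'
      refine ⟨embCell_inj ?_, ?_⟩
      · rw [b2, hemb, hemb, a2, hm]
      · intro i j
        rw [a3, b3, hemb]
        have e := hl (embCell q1 q2 c)
        have e1 : (T.tw q2 τ).lab (Equiv.sigmaCongrRight f (embCell q1 q2 c)) =
          (T.tw q2 π).lab (embCell q1 q2 c) := congrArg Prod.fst e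
        have e2 : (T.tw q2 τ).isTail (Equiv.sigmaCongrRight f (embCell q1 q2 c)) =
          (T.tw q2 π).isTail (embCell q1 q2 c) := Bool.not_inj (congrArg Prod.snd e)
        unfold matOf
        rw [e1, e2]
        rfl
    · have hx : glue q1 q2 hn (embCell q1 q2 c) = embCell q1 q2 c :=
        glue_other hn _ c.1.2
      rw [← glue_fixed hq hn] at hA
      obtain ⟨l, lo, lh, le⟩ := path_at (T.tw q2 π).mate_invol (glue_glue hq hn) _ hx hA
      obtain ⟨a1, a2⟩ := tilde_path _ hq hn h1 D hD l lo c lh le.symm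
      have lo' := opn_map _ hm hg lo
      obtain ⟨b1, b2⟩ := tilde_path _ hq hn h1' D' hD' _ lo' (Equiv.sigmaCongrRight
          (fun i : {i : ι // i ≠ q1 ∧ i ≠ q2} => f i.1) c) (by simpa using lh)
          (by rw [List.head_map, le, hemb])
      refine ⟨embCell_inj ?_, ?_⟩
      · rw [b1, List.getLast_map, ← hm, ← a1, hemb]
      · intro i j
        rw [a2, b2, pathMat_eq_wordMat, pathMat_eq_wordMat]
        have : (T.tw q2 τ).word (l.map (Equiv.sigmaCongrRight f)) = (T.tw q2 π).word l := by
          unfold word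
          rw [List.map_map]
          apply List.map_congr_left
          intro x _
          exact hl x
        rw [this]
        rfl
  refine bpf0_relabel D D' _ (fun c => (key c).1) ?_
  intro c i j hi hj
  exact (key c).2 ⟨i, lt_of_lt_of_le hi (le_dimBound c.1.1)⟩
    ⟨j, lt_of_lt_of_le hj (le_dimBound (D.mate c).1.1)⟩

theorem main (T : TabSub A ι n s) {q1 q2 : ι} (hq : q1 ≠ q2) (hn : n q1 = n q2)
    (π τ : Equiv.Perm (Fin (n q2))) {Ro Rc Ro' Rc' : Finset (List (TabCell n))}
    (h1 : (T.tw q2 π).OpenReps q1 q2 Ro) (h2 : (T.tw q2 π).ClosedReps q1 q2 Rc)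
    (h1' : (T.tw q2 τ).OpenReps q1 q2 Ro') (h2' : (T.tw q2 τ).ClosedReps q1 q2 Rc')
    (ho : Multiset.Rel weqT ((T.tw q2 π).wordsOf Ro) ((T.tw q2 τ).wordsOf Ro'))
    (hc : Multiset.Rel weqCT ((T.tw q2 π).wordsOf Rc) ((T.tw q2 τ).wordsOf Rc')) {t t' : ℕ}
    (D : TabSub A {i : ι // i ≠ q1 ∧ i ≠ q2} (fun i => n i.1) t)
    (D' : TabSub A {i : ι // i ≠ q1 ∧ i ≠ q2} (fun i => n i.1) t')
    (hD : IsTilde (T.tw q2 π) q1 q2 Ro D) (hD' : IsTilde (T.tw q2 τ) q1 q2 Ro' D') :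
    (Equiv.Perm.sign π : ℤ) • (D.bpf0 * trClosed (T.tw q2 π) Rc) =
      (Equiv.Perm.sign τ : ℤ) • (D'.bpf0 * trClosed (T.tw q2 τ) Rc') := by
  obtain ⟨σ, s1, s2, s3⟩ := exists_relabel T hq hn π τ h1 h2 h1' h2' ho hc
  obtain ⟨f, rfl⟩ := exists_sigmaCongr σ (relabel_col T q2 π τ σ s3)
  rw [tilde_relabel T hq hn π τ h1 h1' D D' hD hD' f s1 s2 s3, relabel_sgnT hq hn f s2,
    relabel_sign T q2 π τ _ s3 s1, trClosed_eq T q2 π τ Rc Rc' hc, smul_mul_assoc, smul_smul]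
  congr 1
  rw [Units.val_mul, mul_left_comm, ← Units.val_mul (Equiv.Perm.sign τ), Int.units_mul_self]
  simp

end TabSub

open TabSub in
/-- With `g(T,τ) = sgn(τ)·bpf⁰_{T̃^τ}(X_{T̃^τ})·tr(T^τ_cl)`: if `π ∈ S_τ` then
`g(T,π) = g(T,τ)`. -/
theorem stmt19 (m s : ℕ) (n : Fin (m + 2) → ℕ)
    -- the distinguished columns are the last two: `q1 = m−1`, `q2 = m` (1-based)
    (q1 q2 : Fin (m + 2)) (hq1 : q1 = ⟨m, by omega⟩) (hq2 : q2 = ⟨m + 1, by omega⟩)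
    (hn : n q1 = n q2)
    (T : TabSub ℚ (Fin (m + 2)) n s)
    (Ro Rcl : Equiv.Perm (Fin (n q2)) → Finset (List (TabCell n)))
    (hRo : ∀ τ, (T.tw q2 τ).OpenReps q1 q2 (Ro τ))
    (hRcl : ∀ τ, (T.tw q2 τ).ClosedReps q1 q2 (Rcl τ))
    (D : ∀ τ : Equiv.Perm (Fin (n q2)),
      (t : ℕ) × TabSub ℚ {i : Fin (m + 2) // i ≠ q1 ∧ i ≠ q2} (fun i => n i.1) t)
    (hD : ∀ τ, IsTilde (T.tw q2 τ) q1 q2 (Ro τ) (D τ).2)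
    -- `g(T,·)`
    (g : Equiv.Perm (Fin (n q2)) → ℚ)
    (hg : ∀ τ, g τ = (Equiv.Perm.sign τ : ℤ) •
      ((D τ).2.bpf0 * trClosed (T.tw q2 τ) (Rcl τ)))
    (τ π : Equiv.Perm (Fin (n q2)))
    (hπ : π ∈ T.SPerm q1 q2 Ro Rcl τ) :
    g π = g τ := by
  have hq : q1 ≠ q2 := by
    rw [hq1, hq2]
    intro h
    have := congrArg Fin.val h
    simp at this
  rw [hg, hg]
  exact TabSub.main T hq hn π τ (hRo π) (hRcl π) (hRo τ) (hRcl τ) hπ.1 hπ.2 _ _ (hD π) (hD τ)
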